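/- arXiv:1812.11376 — 2 statements merged into one kernel-verified Lean document; each statement's English description precedes it below -/
import Mathlib

section
/- There is a constant c₂ > 0 depending only on K with the following property. Let F(X₁,X₂) ∈ O_K[X₁,X₂] be irreducible in K̄[X₁,X₂] of total degree d ≥ 2 and let D ≥ d be an integer. Then there exists B₀ (depending on ρ, d, D) such that for every real B ≥ B₀ there exist an integer k ≥ 1 and polynomials F₁, …, F_k ∈ O_K[X₁,X₂], each of total degree at most D and each having no common non-unit factor with F in K̄[X₁,X₂], such that every point (x₁,x₂) ∈ O_K² with F(x₁,x₂) = 0, H(x₁) ≤ B and H(x₂) ≤ B is a zero of at least one of F₁, …, F_k, and moreover k ≤ c₂ · d³ · (log(d³ · H⁺(F) · B^{d−1}))² · B^{ρ(1/d + 6/D)}. -/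
open NumberField

/-- `H⁺(F) = max(1, H(F))` where `H(F)` is the maximum of the houses of the nonzero
coefficients of `F`. -/
noncomputable def mvHousePlus {K : Type*} [Field K] [NumberField K]
    (F : MvPolynomial (Fin 2) (𝓞 K)) : ℝ :=
  max 1 (⨆ m ∈ F.support, house ((F.coeff m : 𝓞 K) : K))

theorem sum_range_le_sum_of_injective {n : ℕ} {r : Fin n → ℕ} (hr : Function.Injective r) :
    n * (n - 1) / 2 ≤ ∑ i, r i := by
  rw [← Finset.sum_range_id]
  have h := Finset.sum_range_le_sum (c := 0)
    (s := Finset.univ.image fun i => (r i : ℤ)) (by simp)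
  have hinj : Function.Injective fun i => (r i : ℤ) := Nat.cast_injective.comp hr
  rw [Finset.card_image_of_injective _ hinj, Finset.card_fin,
    Finset.sum_image fun _ _ _ _ hab => hinj hab] at h
  simp only [zero_add] at h
  have h' : ((∑ i ∈ Finset.range n, i : ℕ) : ℤ) ≤ ((∑ i, r i : ℕ) : ℤ) := by
    push_cast
    exact h
  exact_mod_cast h'

theorem pow_dvd_det_polynomial_eval {A : Type*} [CommRing A] (p x₀ : A) {n : ℕ}
    (t : Fin n → A) (h : Fin n → Polynomial A) :
    p ^ (n * (n - 1) / 2) ∣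
      (Matrix.of fun i j => (h i).eval (x₀ + p * t j)).det := by
  classical
  set q : Fin n → Polynomial A := fun i => (h i).comp (Polynomial.C x₀ + Polynomial.X) with hq
  have hM : (Matrix.of fun i j => (h i).eval (x₀ + p * t j)) =
      Matrix.of fun i => ∑ l ∈ (q i).support, ((q i).coeff l * p ^ l) • fun j => t j ^ l := by
    ext i j
    have : (h i).eval (x₀ + p * t j) = (q i).eval (p * t j) := by simp [hq]
    rw [Matrix.of_apply, Matrix.of_apply, this, Polynomial.eval_eq_sum, Polynomial.sum_def,
      Finset.sum_apply]
    refine Finset.sum_congr rfl fun l _ => ?_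
    simp only [Pi.smul_apply, smul_eq_mul]
    ring
  have hdet : ∀ v : Fin n → Fin n → A, (Matrix.of v).det =
      (Matrix.detRowAlternating (R := A) (n := Fin n)).toMultilinearMap v := fun _ => rfl
  rw [hM, hdet, MultilinearMap.map_sum_finset]
  refine Finset.dvd_sum fun r _ => ?_
  rw [MultilinearMap.map_smul_univ]
  by_cases hr : Function.Injective r
  · rw [Finset.prod_mul_distrib, Finset.prod_pow_eq_pow_sum, smul_eq_mul]
    exact ((pow_dvd_pow p (sum_range_le_sum_of_injective hr)).mul_left _).mul_right _
  · rw [Function.not_injective_iff] at hr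
    obtain ⟨a, b, hab, hne⟩ := hr
    rw [← hdet, Matrix.det_zero_of_row_eq hne (funext fun j => congrArg (t j ^ ·) hab), smul_zero]
    exact dvd_zero _

theorem eval_aeval_X_polynomial {A : Type*} [CommRing A] (F : MvPolynomial (Fin 2) A)
    (g : Polynomial A) (a : A) :
    (MvPolynomial.aeval ![Polynomial.X, g] F).eval a = MvPolynomial.eval ![a, g.eval a] F := by
  rw [← Polynomial.coe_evalRingHom, MvPolynomial.aeval_def, MvPolynomial.hom_eval₂,
    MvPolynomial.eval, MvPolynomial.coe_eval₂Hom]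
  congr 1
  · ext; simp
  · ext k; fin_cases k <;> simp

theorem exists_eval_add_eq {A : Type*} [CommRing A] (F : MvPolynomial (Fin 2) A) (x y h : A) :
    ∃ k, MvPolynomial.eval ![x, y + h] F = MvPolynomial.eval ![x, y] F +
      MvPolynomial.eval ![x, y] (MvPolynomial.pderiv 1 F) * h + k * h ^ 2 := by
  induction F using MvPolynomial.induction_on with
  | C a => exact ⟨0, by simp⟩
  | add f g hf hg =>
    obtain ⟨k, hk⟩ := hf
    obtain ⟨l, hl⟩ := hg
    exact ⟨k + l, by simp only [map_add, hk, hl]; ring⟩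
  | mul_X f i hf =>
    obtain ⟨k, hk⟩ := hf
    fin_cases i
    · refine ⟨k * x, ?_⟩
      simp [hk, Derivation.leibniz, MvPolynomial.pderiv_X]
      ring
    · refine ⟨k * (y + h) + MvPolynomial.eval ![x, y] (MvPolynomial.pderiv 1 f), ?_⟩
      simp [hk, Derivation.leibniz, MvPolynomial.pderiv_X]
      ring

theorem dvd_eval_sub_eval {A : Type*} [CommRing A] {σ : Type*} (F : MvPolynomial σ A) {p : A}
    {x y : σ → A} (h : ∀ i, p ∣ x i - y i) :
    p ∣ MvPolynomial.eval x F - MvPolynomial.eval y F := by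
  induction F using MvPolynomial.induction_on with
  | C a => simp
  | add f g hf hg =>
    simp only [map_add]
    convert dvd_add hf hg using 1
    ring
  | mul_X f i hf =>
    simp only [map_mul, MvPolynomial.eval_X]
    convert dvd_add (hf.mul_right (x i)) ((h i).mul_left (MvPolynomial.eval y f)) using 1
    ring

theorem exists_polynomial_approximation {A ι : Type*} [CommRing A] {F : MvPolynomial (Fin 2) A}
    {p w : A} {x : ι → Fin 2 → A} {x₀ : Fin 2 → A} (hF : ∀ i, MvPolynomial.eval (x i) F = 0)
    (hx : ∀ i k, p ∣ x i k - x₀ k)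
    (hw : p ∣ w * MvPolynomial.eval x₀ (MvPolynomial.pderiv 1 F) - 1) (N : ℕ) :
    ∃ g : Polynomial A, ∀ i, p ∣ x i 1 - g.eval (x i 0) ∧ p ^ N ∣ x i 1 - g.eval (x i 0) := by
  induction N with
  | zero => exact ⟨Polynomial.C (x₀ 1), fun i => by simpa using hx i 1⟩
  | succ N ih =>
    obtain ⟨g, hg⟩ := ih
    refine ⟨g - Polynomial.C w * MvPolynomial.aeval ![Polynomial.X, g] F, fun i => ?_⟩
    obtain ⟨k, hk⟩ := exists_eval_add_eq F (x i 0) (x i 1) (g.eval (x i 0) - x i 1)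
    have hxi : ![x i 0, x i 1] = x i := by ext k; fin_cases k <;> rfl
    rw [hxi, hF i, add_sub_cancel] at hk
    have hd := dvd_eval_sub_eval (MvPolynomial.pderiv 1 F) (hx i)
    set E := x i 1 - g.eval (x i 0) with hE
    have hkey : x i 1 - (g - Polynomial.C w * MvPolynomial.aeval ![Polynomial.X, g] F).eval (x i 0)
        = E * (-(w * MvPolynomial.eval x₀ (MvPolynomial.pderiv 1 F) - 1)
          - w * (MvPolynomial.eval (x i) (MvPolynomial.pderiv 1 F)
            - MvPolynomial.eval x₀ (MvPolynomial.pderiv 1 F)) + w * k * E) := by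
      rw [Polynomial.eval_sub, Polynomial.eval_mul, Polynomial.eval_C, eval_aeval_X_polynomial,
        hk, hE]
      ring
    have hp : p ∣ (-(w * MvPolynomial.eval x₀ (MvPolynomial.pderiv 1 F) - 1)
          - w * (MvPolynomial.eval (x i) (MvPolynomial.pderiv 1 F)
            - MvPolynomial.eval x₀ (MvPolynomial.pderiv 1 F)) + w * k * E) :=
      dvd_add (dvd_sub (dvd_neg.2 hw) (hd.mul_left _)) ((hg i).1.mul_left _)
    rw [hkey, pow_succ]
    exact ⟨hp.mul_left _, mul_dvd_mul (hg i).2 hp⟩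

theorem pow_dvd_det_eval {A : Type*} [CommRing A] {F : MvPolynomial (Fin 2) A}
    {p w : A} {n : ℕ} {x : Fin n → Fin 2 → A} {x₀ : Fin 2 → A}
    (hF : ∀ i, MvPolynomial.eval (x i) F = 0) (hx : ∀ i k, p ∣ x i k - x₀ k)
    (hw : p ∣ w * MvPolynomial.eval x₀ (MvPolynomial.pderiv 1 F) - 1)
    (Q : Fin n → MvPolynomial (Fin 2) A) :
    p ^ (n * (n - 1) / 2) ∣ (Matrix.of fun i j => MvPolynomial.eval (x j) (Q i)).det := by
  set N := n * (n - 1) / 2 with hN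
  obtain ⟨g, hg⟩ := exists_polynomial_approximation hF hx hw N
  choose t ht using fun i => hx i 0
  set h : Fin n → Polynomial A := fun j => MvPolynomial.aeval ![Polynomial.X, g] (Q j) with hh
  have hev : ∀ i j, (h i).eval (x₀ 0 + p * t j) =
      MvPolynomial.eval ![x j 0, g.eval (x j 0)] (Q i) := by
    intro i j
    rw [← ht j, add_sub_cancel, hh, eval_aeval_X_polynomial]
  have hdet := pow_dvd_det_polynomial_eval p (x₀ 0) t h
  rw [← hN] at hdet
  rw [← Ideal.mem_span_singleton, ← Ideal.Quotient.eq_zero_iff_mem] at hdet ⊢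
  rw [← hdet, RingHom.map_det, RingHom.map_det]
  congr 1
  ext i j
  simp only [RingHom.mapMatrix_apply, Matrix.map_apply, Matrix.of_apply]
  rw [Ideal.Quotient.eq, Ideal.mem_span_singleton, hev]
  refine dvd_eval_sub_eval _ fun k => ?_
  fin_cases k
  · simp
  · simpa using (hg j).2

theorem exists_monomials_of_degree (e : Fin 2 →₀ ℕ) (n : ℕ) :
    ∃ L : Finset (Fin 2 →₀ ℕ), (∀ m ∈ L, m.degree = n ∧ ¬ e ≤ m) ∧ L.card ≤ n + 1 ∧
      (e.degree ≤ L.card ∨ n + 1 ≤ L.card) := by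
  classical
  set φ : ℕ → Fin 2 →₀ ℕ := fun a => Finsupp.single 0 a + Finsupp.single 1 (n - a) with hφ
  have hφ0 : ∀ a, φ a 0 = a := fun a => by simp [hφ]
  have hφ1 : ∀ a, φ a 1 = n - a := fun a => by simp [hφ]
  have hinj : Function.Injective φ := fun a b hab => by rw [← hφ0 a, hab, hφ0]
  have he : e.degree = e 0 + e 1 := by simp [Finsupp.degree_eq_sum]
  refine ⟨(Finset.range (n + 1) \ Finset.Ico (e 0) (n + 1 - e 1)).image φ, ?_, ?_, ?_⟩
  · intro m hm
    simp only [Finset.mem_image, Finset.mem_sdiff, Finset.mem_range, Finset.mem_Ico] at hm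
    obtain ⟨a, ⟨ha, hna⟩, rfl⟩ := hm
    refine ⟨?_, fun hle => hna ?_⟩
    · rw [Finsupp.degree_eq_sum, Fin.sum_univ_two, hφ0, hφ1]
      omega
    · have h0 := hle 0
      have h1 := hle 1
      rw [hφ0] at h0
      rw [hφ1] at h1
      omega
  · rw [Finset.card_image_of_injective _ hinj]
    exact (Finset.card_le_card Finset.sdiff_subset).trans (Finset.card_range _).le
  · rw [Finset.card_image_of_injective _ hinj]
    have := Finset.le_card_sdiff (Finset.Ico (e 0) (n + 1 - e 1)) (Finset.range (n + 1))
    rw [Nat.card_Ico, Finset.card_range] at this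
    omega

theorem exists_monomials_degree_lt (e : Fin 2 →₀ ℕ) (n : ℕ) :
    ∃ E : Finset (Fin 2 →₀ ℕ), (∀ m ∈ E, m.degree < n ∧ ¬ e ≤ m) ∧ E.card ≤ n ^ 2 ∧
      (n ≤ e.degree → n * (n + 1) ≤ 2 * E.card) ∧
      2 * e.degree * n + e.degree ≤ 2 * E.card + e.degree ^ 2 ∧
      2 * e.degree * (∑ m ∈ E, m.degree) + E.card + E.card * e.degree ≤
        E.card ^ 2 + E.card * e.degree ^ 2 := by
  classical
  set d := e.degree
  induction n with
  | zero =>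
    exact ⟨∅, by simp, by simp, by simp, by simpa using Nat.le_self_pow two_ne_zero d, by simp⟩
  | succ n ih =>
    obtain ⟨E, hE, hcard, hlow, hs, hW⟩ := ih
    obtain ⟨L, hL, hLcard, hc⟩ := exists_monomials_of_degree e n
    have hdisj : Disjoint E L := Finset.disjoint_left.2 fun m hm hm' =>
      (hE m hm).1.ne (hL m hm').1
    have hsum : ∑ m ∈ L, m.degree = L.card * n := by
      rw [Finset.sum_congr rfl fun m hm => (hL m hm).1, Finset.sum_const, smul_eq_mul]
    refine ⟨E ∪ L, ?_, ?_, ?_, ?_, ?_⟩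
    · intro m hm
      rcases Finset.mem_union.1 hm with hm | hm
      · exact ⟨(hE m hm).1.trans (Nat.lt_succ_self n), (hE m hm).2⟩
      · exact ⟨(hL m hm).1.trans_lt (Nat.lt_succ_self n), (hL m hm).2⟩
    · rw [Finset.card_union_of_disjoint hdisj]
      nlinarith
    · rw [Finset.card_union_of_disjoint hdisj]
      intro hn
      have h1 := hlow (by omega)
      have h2 : n + 1 ≤ L.card := by omega
      nlinarith
    · rw [Finset.card_union_of_disjoint hdisj]
      by_cases hd : d ≤ L.card
      · nlinarith
      · have hn : n + 1 ≤ d := by omega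
        have h1 := hlow (by omega)
        have h2 : n + 1 ≤ L.card := by omega
        obtain ⟨k, hk⟩ := Nat.exists_eq_add_of_le hn
        rw [hk] at hs ⊢
        nlinarith [Nat.le_self_pow two_ne_zero k]
    · rw [Finset.card_union_of_disjoint hdisj, Finset.sum_union hdisj, hsum]
      have h1 : L.card ≤ L.card ^ 2 := Nat.le_self_pow two_ne_zero _
      nlinarith [Nat.mul_le_mul_left L.card hs]

theorem exists_monomials (e : Fin 2 →₀ ℕ) (D : ℕ) (he : 2 ≤ e.degree) (hD : e.degree ≤ D) :
    ∃ E : Finset (Fin 2 →₀ ℕ), (∀ m ∈ E, m.degree ≤ D ∧ ¬ e ≤ m) ∧ E.card ≤ (D + 1) ^ 2 ∧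
      2 ≤ E.card ∧
      ((∑ m ∈ E, m.degree : ℕ) : ℝ) ≤
        ((E.card * (E.card - 1) / 2 : ℕ) : ℝ) * (1 / (e.degree : ℝ) + 2 / (D : ℝ)) := by
  obtain ⟨E, hE, hcard, -, hs, hW⟩ := exists_monomials_degree_lt e (D + 1)
  set d := e.degree
  set s := E.card
  set W := ∑ m ∈ E, m.degree
  have h1 : d * D + 2 ≤ 2 * s := by nlinarith
  have h2 : 2 ≤ s := by nlinarith
  refine ⟨E, fun m hm => ⟨Nat.le_of_lt_succ (hE m hm).1, (hE m hm).2⟩, hcard, h2, ?_⟩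
  have hd0 : (0 : ℝ) < d := by exact_mod_cast (by omega : 0 < d)
  have hD0 : (0 : ℝ) < D := by exact_mod_cast (by omega : 0 < D)
  rw [Nat.cast_div (Nat.even_mul_pred_self s).two_dvd (by norm_num),
    Nat.cast_mul, Nat.cast_pred (by omega)]
  have hW' : 2 * (d : ℝ) * W + s + s * d ≤ s ^ 2 + s * d ^ 2 := by exact_mod_cast hW
  have h1' : (d : ℝ) * D + 2 ≤ 2 * s := by exact_mod_cast h1
  have hs0 : (0 : ℝ) < s := by exact_mod_cast (by omega : 0 < s)
  have hd1 : (1 : ℝ) ≤ d := by exact_mod_cast (by omega : 1 ≤ d)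
  have key : (s : ℝ) * (s - 1) / ((2 : ℕ) : ℝ) * (1 / d + 2 / D) - W =
      (D * (s * (s - 1) - 2 * d * W) + 2 * d * s * (s - 1)) / (2 * d * D) := by
    field_simp
    push_cast
    ring
  have : 0 ≤ (D * (s * (s - 1) - 2 * d * W) + 2 * d * s * (s - 1) : ℝ) := by
    have a1 : (D : ℝ) * (s * (d - d ^ 2)) ≤ D * (s * (s - 1) - 2 * d * W) :=
      mul_le_mul_of_nonneg_left (by linarith) hD0.le
    have a2 : (d : ℝ) * s * (d * D) ≤ d * s * (2 * (s - 1)) :=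
      mul_le_mul_of_nonneg_left (by linarith) (by positivity)
    have a3 : 0 ≤ (D : ℝ) * (s * d) := by positivity
    nlinarith
  have := div_nonneg this (by positivity : (0 : ℝ) ≤ 2 * d * D)
  linarith

theorem exists_siegel_bound (K : Type*) [Field K] [NumberField K] :
    ∃ C : ℝ, 1 ≤ C ∧ ∀ (α β : Type) [Fintype α] [Fintype β] (a : Matrix α β (𝓞 K)) (A : ℝ),
      1 ≤ A → Fintype.card α < Fintype.card β → (∀ k l, house (a k l : K) ≤ A) →
      ∃ ξ : β → 𝓞 K, ξ ≠ 0 ∧ a.mulVec ξ = 0 ∧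
        ∀ l, house (ξ l : K) ≤ C * (C * Fintype.card β * A) ^ Fintype.card β := by
  classical
  obtain ⟨c, hc⟩ : ∃ c : ℝ, ∀ (α β : Type) [Fintype α] [Fintype β] (a : Matrix α β (𝓞 K))
      (A : ℝ), a ≠ 0 → 0 < Fintype.card α → Fintype.card α < Fintype.card β →
      (∀ k l, house (a k l : K) ≤ A) →
      ∃ ξ : β → 𝓞 K, ξ ≠ 0 ∧ a.mulVec ξ = 0 ∧
        ∀ l, house (ξ l : K) ≤ c * (c * Fintype.card β * A) ^
          ((Fintype.card α : ℝ) / (Fintype.card β - Fintype.card α)) :=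
    ⟨_, fun α β _ _ a A ha h0 hlt hA =>
      house.exists_ne_zero_int_vec_house_le K a ha h0 hlt rfl hA rfl⟩
  refine ⟨max |c| 1, le_max_right _ _, fun α β _ _ a A hA hlt ha => ?_⟩
  set C := max |c| 1
  have hC : 1 ≤ C := le_max_right _ _
  have hβ : 1 ≤ (Fintype.card β : ℝ) := by exact_mod_cast (by omega : 1 ≤ Fintype.card β)
  have hbase : 1 ≤ C * Fintype.card β * A := one_le_mul_of_one_le_of_one_le
    (one_le_mul_of_one_le_of_one_le hC hβ) hA
  by_cases ha0 : a = 0 ∨ Fintype.card α = 0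
  · have : Nonempty β := Fintype.card_pos_iff.1 (by omega)
    refine ⟨fun _ => 1, fun h => one_ne_zero (congrFun h (Classical.arbitrary β)), ?_, fun l => ?_⟩
    · rcases ha0 with rfl | h
      · simp
      · have := Fintype.card_eq_zero_iff.1 h
        exact Subsingleton.elim _ _
    · have : house ((1 : 𝓞 K) : K) = 1 := by simpa using house_intCast (K := K) 1
      rw [this]
      exact one_le_mul_of_one_le_of_one_le hC (one_le_pow₀ hbase)
  · push Not at ha0
    obtain ⟨ξ, h0, h1, h2⟩ := hc α β a A ha0.1 (Nat.pos_of_ne_zero ha0.2) hlt ha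
    refine ⟨ξ, h0, h1, fun l => (h2 l).trans ?_⟩
    have hle : (1 : ℝ) ≤ (Fintype.card β : ℝ) - Fintype.card α := by
      have : ((Fintype.card α + 1 : ℕ) : ℝ) ≤ Fintype.card β := by exact_mod_cast hlt
      push_cast at this
      linarith
    set t : ℝ := (Fintype.card α : ℝ) / (Fintype.card β - Fintype.card α) with ht
    have ht0 : 0 ≤ t := by positivity
    have ht1 : t ≤ Fintype.card β :=
      (div_le_self (Nat.cast_nonneg _) hle).trans (by exact_mod_cast hlt.le)
    calc c * (c * Fintype.card β * A) ^ t
        ≤ |c * (c * Fintype.card β * A) ^ t| := le_abs_self _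
      _ ≤ |c| * |c * Fintype.card β * A| ^ t := by
        rw [abs_mul]
        exact mul_le_mul_of_nonneg_left (Real.abs_rpow_le_abs_rpow _ _) (abs_nonneg _)
      _ ≤ C * (C * Fintype.card β * A) ^ t := by
        rw [abs_mul, abs_mul, abs_of_nonneg (by linarith : (0 : ℝ) ≤ Fintype.card β),
          abs_of_nonneg (by linarith : (0 : ℝ) ≤ A)]
        have : |c| ≤ C := le_max_left _ _
        gcongr
      _ ≤ C * (C * Fintype.card β * A) ^ (Fintype.card β : ℝ) := by
        gcongr
      _ = _ := by rw [Real.rpow_natCast]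

theorem exists_det_ne_zero_or_exists_relation (K : Type*) [Field K] [NumberField K] :
    ∃ C : ℝ, 1 ≤ C ∧ ∀ (ι : Type) [Fintype ι] [DecidableEq ι] (X : Type*) (T : Set X)
      (φ : X → ι → 𝓞 K) (A : ℝ), 1 ≤ A → (∀ x ∈ T, ∀ i, house (φ x i : K) ≤ A) →
      (∃ f : ι → X, (∀ i, f i ∈ T) ∧ (Matrix.of fun i j => φ (f j) i).det ≠ 0) ∨
      ∃ ξ : ι → 𝓞 K, ξ ≠ 0 ∧ (∀ x ∈ T, ∑ i, ξ i * φ x i = 0) ∧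
        ∀ l, house (ξ l : K) ≤ C * (C * Fintype.card ι * A) ^ Fintype.card ι := by
  obtain ⟨C, hC, hS⟩ := exists_siegel_bound K
  refine ⟨C, hC, fun ι _ _ X T φ A hA hφ => ?_⟩
  set v : X → ι → K := fun x i => (φ x i : K) with hv
  obtain ⟨b, hbT, hspan, hli⟩ := exists_linearIndependent K (v '' T)
  have hfin : Fintype b := hli.setFinite.fintype
  have hcard : Fintype.card b ≤ Fintype.card ι := by
    simpa using hli.fintype_card_le_finrank
  choose g hgT hg using fun y : b => hbT y.2
  rcases hcard.lt_or_eq with hlt | heq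
  · right
    obtain ⟨ξ, h0, h1, h2⟩ := hS (Fin (Fintype.card b)) ι
      (fun k i => φ (g ((Fintype.equivFin b).symm k)) i) A hA (by simpa using hlt)
      fun k l => hφ _ (hgT _) l
    refine ⟨ξ, h0, fun x hx => ?_, h2⟩
    set L : (ι → K) →ₗ[K] K := Fintype.linearCombination K (fun i => (ξ i : K)) with hL
    have hLa : ∀ x, L (v x) = ((∑ i, ξ i * φ x i : 𝓞 K) : K) := fun x => by
      simp [hL, hv, Fintype.linearCombination_apply, mul_comm]
    have hle : Submodule.span K (v '' T) ≤ LinearMap.ker L := by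
      rw [← hspan, Submodule.span_le]
      intro y hy
      have := congrFun h1 (Fintype.equivFin b ⟨y, hy⟩)
      simp only [Matrix.mulVec, dotProduct, Equiv.symm_apply_apply, Pi.zero_apply] at this
      rw [SetLike.mem_coe, LinearMap.mem_ker, ← show v (g ⟨y, hy⟩) = y from hg ⟨y, hy⟩, hLa]
      simp_rw [mul_comm (ξ _)]
      rw [this]
      exact map_zero _
    have := hle (Submodule.subset_span (Set.mem_image_of_mem v hx))
    rw [LinearMap.mem_ker, hLa] at this
    exact RingOfIntegers.coe_eq_zero_iff.1 this
  · left
    set e : ι ≃ b := (Fintype.equivOfCardEq heq).symm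
    refine ⟨fun i => g (e i), fun i => hgT _, fun hdet => ?_⟩
    have hrow : LinearIndependent K (Matrix.of fun i j => ((φ (g (e i)) j : 𝓞 K) : K)).row := by
      have hrow_eq : (Matrix.of fun i j => ((φ (g (e i)) j : 𝓞 K) : K)).row =
          fun i => (e i : ι → K) := by
        ext i j
        rw [← hg (e i)]
        rfl
      rw [hrow_eq]
      exact hli.comp e e.injective
    rw [Matrix.linearIndependent_rows_iff_isUnit, Matrix.isUnit_iff_isUnit_det,
      isUnit_iff_ne_zero] at hrow
    apply hrow
    have := congrArg (algebraMap (𝓞 K) K) hdet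
    rw [RingHom.map_det, map_zero] at this
    rw [← Matrix.det_transpose, ← this]
    rfl

theorem ncard_simple_roots_le {R : Type*} [CommRing R] [Finite R] {f : Polynomial R} {d : ℕ}
    (hf : f.natDegree ≤ d) :
    {b : R | f.eval b = 0 ∧ IsUnit (f.derivative.eval b)}.ncard ≤
      d ^ Nat.card (MaximalSpectrum R) := by
  classical
  set S := {b : R | f.eval b = 0 ∧ IsUnit (f.derivative.eval b)} with hS
  have : Fintype (MaximalSpectrum R) := Fintype.ofFinite _
  let g : ∀ M : MaximalSpectrum R, Polynomial (R ⧸ M.asIdeal) :=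
    fun M => f.map (Ideal.Quotient.mk M.asIdeal)
  have hroot : ∀ b ∈ S, ∀ M : MaximalSpectrum R,
      Ideal.Quotient.mk M.asIdeal b ∈ (g M).roots.toFinset := by
    intro b hb M
    have := M.isMaximal
    rw [Multiset.mem_toFinset, Polynomial.mem_roots']
    refine ⟨fun h0 => ?_, ?_⟩
    · have hu := hb.2.map (Ideal.Quotient.mk M.asIdeal)
      rw [← Polynomial.eval_map_apply, ← Polynomial.derivative_map] at hu
      simp only [g] at h0
      rw [h0] at hu
      simp at hu
    · rw [Polynomial.IsRoot, Polynomial.eval_map_apply, hb.1, map_zero]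
  have hinj : Function.Injective fun (b : S) (M : MaximalSpectrum R) =>
      (⟨Ideal.Quotient.mk M.asIdeal b, hroot b b.2 M⟩ : (g M).roots.toFinset) := by
    rintro ⟨a, ha⟩ ⟨b, hb⟩ hab
    obtain ⟨k, hk⟩ := Polynomial.binomExpansion f b (a - b)
    rw [add_sub_cancel, ha.1, hb.1] at hk
    have hu : IsUnit (f.derivative.eval b + k * (a - b)) := by
      by_contra hnu
      obtain ⟨I, hI, hmem⟩ := exists_max_ideal_of_mem_nonunits hnu
      have hI' : a - b ∈ I :=
        Ideal.Quotient.eq.1 (congrArg Subtype.val (congrFun hab ⟨I, hI⟩))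
      have := (Ideal.add_mem_iff_left I (I.mul_mem_left k hI')).1 hmem
      exact hI.ne_top (Ideal.eq_top_of_isUnit_mem _ this hb.2)
    have h0 : (f.derivative.eval b + k * (a - b)) * (a - b) = 0 := by
      rw [← sub_eq_zero] at hk
      linear_combination -hk
    exact Subtype.ext (sub_eq_zero.1 ((hu.mul_right_eq_zero).1 h0))
  have := Nat.card_le_card_of_injective _ hinj
  rw [Nat.card_coe_set_eq, Nat.card_pi] at this
  refine this.trans ?_
  rw [Nat.card_eq_fintype_card, ← Finset.card_univ, ← Finset.prod_const]
  refine Finset.prod_le_prod' fun M _ => ?_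
  have := M.isMaximal
  rw [Nat.card_eq_fintype_card, Fintype.card_coe]
  exact (Multiset.toFinset_card_le _).trans ((Polynomial.card_roots' _).trans
    (Polynomial.natDegree_map_le.trans hf))

theorem natCard_maximalSpectrum_le {R : Type*} [CommRing R] [Finite R] {q n : ℕ}
    (hq : q.Prime) (hR : (q : R) = 0) (hcard : Nat.card R = q ^ n) :
    Nat.card (MaximalSpectrum R) ≤ n := by
  have : Fintype (MaximalSpectrum R) := Fintype.ofFinite _
  have hsurj : Function.Surjective fun (r : R) (M : MaximalSpectrum R) =>
      Ideal.Quotient.mk M.asIdeal r := fun x => by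
    obtain ⟨r, hr⟩ := Ideal.pi_quotient_surjective
      (I := fun M : MaximalSpectrum R => M.asIdeal)
      (fun M N h => MaximalSpectrum.isCoprime_of_ne h) x
    exact ⟨r, funext hr⟩
  have hle := Nat.card_le_card_of_surjective _ hsurj
  rw [Nat.card_pi, hcard] at hle
  have hM : ∀ M : MaximalSpectrum R, q ≤ Nat.card (R ⧸ M.asIdeal) := by
    intro M
    have := M.isMaximal
    have := Finite.of_surjective _ (Ideal.Quotient.mk_surjective (I := M.asIdeal))
    have hord : addOrderOf (1 : R ⧸ M.asIdeal) = q := by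
      have : Fact q.Prime := ⟨hq⟩
      refine addOrderOf_eq_prime ?_ one_ne_zero
      rw [nsmul_one, ← map_natCast (Ideal.Quotient.mk M.asIdeal), hR, map_zero]
    exact Nat.le_of_dvd Nat.card_pos (hord ▸ addOrderOf_dvd_natCard _)
  have := (Finset.prod_le_prod' fun M (_ : M ∈ Finset.univ) => hM M).trans hle
  rw [Finset.prod_const, Finset.card_univ, ← Nat.card_eq_fintype_card] at this
  exact (Nat.pow_le_pow_iff_right hq.one_lt).1 this

theorem natDegree_aeval_C_X_le {R : Type*} [CommRing R] (F : MvPolynomial (Fin 2) R) (a : R) :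
    (MvPolynomial.aeval ![Polynomial.C a, Polynomial.X] F).natDegree ≤ F.totalDegree := by
  rw [MvPolynomial.aeval_def, MvPolynomial.eval₂_eq']
  refine Polynomial.natDegree_sum_le_of_forall_le _ _ fun m hm => ?_
  have h1 := MvPolynomial.le_totalDegree hm
  rw [Finsupp.sum_fintype _ _ (by simp), Fin.sum_univ_two] at h1
  simp only [Fin.prod_univ_two, Matrix.cons_val_zero, Matrix.cons_val_one]
  rw [Polynomial.algebraMap_eq, ← Polynomial.C_pow, ← mul_assoc, ← Polynomial.C_mul]
  exact (Polynomial.natDegree_C_mul_X_pow_le _ _).trans (by omega)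

theorem derivative_aeval_C_X {R : Type*} [CommRing R] (F : MvPolynomial (Fin 2) R) (a : R) :
    Polynomial.derivative (MvPolynomial.aeval ![Polynomial.C a, Polynomial.X] F) =
      MvPolynomial.aeval ![Polynomial.C a, Polynomial.X] (MvPolynomial.pderiv 1 F) := by
  induction F using MvPolynomial.induction_on with
  | C c => simp
  | add f g hf hg => simp [hf, hg]
  | mul_X f i hf =>
    fin_cases i
    · simp [hf, Derivation.leibniz, MvPolynomial.pderiv_X, mul_comm]
    · simp [hf, Derivation.leibniz, MvPolynomial.pderiv_X, mul_comm]

theorem eval_aeval_C_X {R : Type*} [CommRing R] (F : MvPolynomial (Fin 2) R) (a b : R) :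
    (MvPolynomial.aeval ![Polynomial.C a, Polynomial.X] F).eval b =
      MvPolynomial.eval ![a, b] F := by
  rw [← Polynomial.coe_evalRingHom, MvPolynomial.aeval_def, MvPolynomial.hom_eval₂,
    MvPolynomial.eval, MvPolynomial.coe_eval₂Hom]
  congr 1
  · ext; simp
  · ext k; fin_cases k <;> simp

theorem ncard_simple_zeros_le {R : Type*} [CommRing R] [Finite R] (F : MvPolynomial (Fin 2) R)
    {q n d : ℕ} (hd : 1 ≤ d) (hF : F.totalDegree ≤ d) (hq : q.Prime) (hR : (q : R) = 0)
    (hcard : Nat.card R = q ^ n) :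
    {z : Fin 2 → R | MvPolynomial.eval z F = 0 ∧
      IsUnit (MvPolynomial.eval z (MvPolynomial.pderiv 1 F))}.ncard ≤ d ^ n * q ^ n := by
  classical
  have : Fintype R := Fintype.ofFinite R
  set S := {z : Fin 2 → R | MvPolynomial.eval z F = 0 ∧
      IsUnit (MvPolynomial.eval z (MvPolynomial.pderiv 1 F))}
  rw [Set.ncard_eq_toFinset_card']
  have h := Finset.card_le_mul_card_image (f := fun z : Fin 2 → R => z 0) S.toFinset (d ^ n)
    fun a _ => by
      have hle := ncard_simple_roots_le (natDegree_aeval_C_X_le F a)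
      rw [derivative_aeval_C_X] at hle
      simp only [eval_aeval_C_X] at hle
      refine le_trans ?_ (hle.trans ((Nat.pow_le_pow_left hF _).trans
        (Nat.pow_le_pow_right hd (natCard_maximalSpectrum_le hq hR hcard))))
      rw [Set.ncard_eq_toFinset_card']
      refine Finset.card_le_card_of_injOn (fun z => z 1) ?_ ?_
      · intro z hz
        simp only [Finset.coe_filter, Set.mem_toFinset, Set.mem_ofPred_eq, S] at hz
        have hz' : ![a, z 1] = z := by
          rw [← hz.2]
          ext k; fin_cases k <;> rfl
        simp only [Set.coe_toFinset, Set.mem_ofPred_eq]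
        rw [hz']
        exact hz.1
      · intro z hz w hw hzw
        simp only [Finset.coe_filter, Set.mem_ofPred_eq] at hz hw
        ext k
        fin_cases k
        · exact hz.2.trans hw.2.symm
        · exact hzw
  refine h.trans (Nat.mul_le_mul_left _ ?_)
  rw [← hcard, Nat.card_eq_fintype_card]
  exact Finset.card_le_univ _

theorem natCard_quotient_span_natCast (K : Type*) [Field K] [NumberField K] (q : ℕ) :
    Nat.card (𝓞 K ⧸ Ideal.span {(q : 𝓞 K)}) = q ^ Module.finrank ℚ K := by
  have h := Ideal.absNorm_span_singleton (q : 𝓞 K)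
  rw [← map_natCast (algebraMap ℤ (𝓞 K)) q, Algebra.norm_algebraMap, RingOfIntegers.rank] at h
  rw [← Submodule.cardQuot_apply, ← Ideal.absNorm_apply]
  simpa [Int.natAbs_pow] using h

theorem exists_dvd_natCast (K : Type*) [Field K] [NumberField K] {y : 𝓞 K} (hy : y ≠ 0) :
    ∃ n : ℕ, n ≠ 0 ∧ y ∣ (n : 𝓞 K) ∧ (n : ℝ) ≤ house (y : K) ^ Module.finrank ℚ K := by
  refine ⟨Ideal.absNorm (Ideal.span {y}), ?_, ?_, ?_⟩
  · rwa [Ne, Ideal.absNorm_eq_zero_iff, Ideal.span_singleton_eq_bot]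
  · exact Ideal.mem_span_singleton.1 (Ideal.absNorm_mem _)
  · rw [Ideal.absNorm_span_singleton]
    have h1 : ((Algebra.norm ℤ y).natAbs : ℝ) = ‖Algebra.norm ℚ (y : K)‖ := by
      rw [← Algebra.coe_norm_int, Nat.cast_natAbs]
      simp [Int.norm_eq_abs]
    have φ : K →+* ℂ := Classical.arbitrary _
    rw [h1]
    refine (norm_norm_le_norm_mul_house_pow (y : K) φ).trans ?_
    have hpos : Module.finrank ℚ K = (Module.finrank ℚ K - 1) + 1 :=
      (Nat.succ_pred_eq_of_pos Module.finrank_pos).symm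
    calc _ ≤ house (y : K) * house (y : K) ^ (Module.finrank ℚ K - 1) := by
          gcongr
          · exact pow_nonneg (house_nonneg _) _
          · exact norm_embedding_le_house _ _
      _ = _ := by conv_rhs => rw [hpos, pow_succ']

theorem house_prod_le_prod_house {K ι : Type*} [Field K] [NumberField K] (s : Finset ι)
    (f : ι → K) : house (∏ i ∈ s, f i) ≤ ∏ i ∈ s, house (f i) := by
  simpa [house, map_prod] using Finset.norm_prod_le s fun i => canonicalEmbedding K (f i)

theorem house_eval_monomial_le {K : Type*} [Field K] [NumberField K] {x : Fin 2 → 𝓞 K} {B : ℝ}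
    (hx : ∀ i, house (x i : K) ≤ B) (m : Fin 2 →₀ ℕ) (c : 𝓞 K) :
    house (MvPolynomial.eval x (MvPolynomial.monomial m c) : K) ≤
      house (c : K) * B ^ m.degree := by
  have hpow (i : Fin 2) : house ((x i : K) ^ m i) ≤ B ^ m i :=
    (house_pow_le _ _).trans (pow_le_pow_left₀ (house_nonneg _) (hx i) _)
  have heval : (MvPolynomial.eval x (MvPolynomial.monomial m c) : K) =
      c * ((x 0 : K) ^ m 0 * (x 1 : K) ^ m 1) := by
    rw [MvPolynomial.eval_monomial, Finsupp.prod_fintype _ _ (by simp), Fin.prod_univ_two]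
    simp
  rw [heval, Finsupp.degree_eq_sum, Fin.sum_univ_two, pow_add]
  refine (house_mul_le _ _).trans (mul_le_mul_of_nonneg_left ?_ (house_nonneg _))
  exact (house_mul_le _ _).trans (mul_le_mul (hpow 0) (hpow 1) (house_nonneg _)
    ((house_nonneg _).trans (hpow 0)))

theorem card_support_le {R : Type*} [CommSemiring R] (Q : MvPolynomial (Fin 2) R) {n : ℕ}
    (hQ : Q.totalDegree ≤ n) : Q.support.card ≤ (n + 1) ^ 2 := by
  have h := Finset.card_le_card_of_injOn (s := Q.support)
    (t := Finset.range (n + 1) ×ˢ Finset.range (n + 1)) (fun m => (m 0, m 1)) ?_ ?_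
  · simpa [sq] using h
  · intro m hm
    have h1 : m.degree ≤ n := (MvPolynomial.le_totalDegree hm).trans hQ
    rw [Finsupp.degree_eq_sum, Fin.sum_univ_two] at h1
    simp only [Finset.coe_product, Finset.coe_range, Set.mem_prod, Set.mem_Iio]
    omega
  · intro m _ m' _ h
    simp only [Prod.mk.injEq] at h
    ext k
    fin_cases k
    · exact h.1
    · exact h.2

theorem house_eval_le {K : Type*} [Field K] [NumberField K] {x : Fin 2 → 𝓞 K} {B H : ℝ} {n : ℕ}
    (hB : 1 ≤ B) (hx : ∀ i, house (x i : K) ≤ B) {Q : MvPolynomial (Fin 2) (𝓞 K)}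
    (hQ : Q.totalDegree ≤ n) (hH : ∀ m, house ((Q.coeff m : 𝓞 K) : K) ≤ H) :
    house (MvPolynomial.eval x Q : K) ≤ (n + 1) ^ 2 * (H * B ^ n) := by
  have hH0 : 0 ≤ H := (house_nonneg _).trans (hH 0)
  have heval : (MvPolynomial.eval x Q : K) = ∑ m ∈ Q.support,
      (MvPolynomial.eval x (MvPolynomial.monomial m (Q.coeff m)) : K) := by
    conv_lhs => rw [Q.as_sum]
    rw [map_sum]
    exact map_sum (algebraMap (𝓞 K) K) _ _
  rw [heval]
  calc _ ≤ ∑ m ∈ Q.support, H * B ^ n := by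
        refine (house_sum_le_sum_house _ _).trans (Finset.sum_le_sum fun m hm => ?_)
        refine (house_eval_monomial_le hx _ _).trans ?_
        have : m.degree ≤ n := (MvPolynomial.le_totalDegree hm).trans hQ
        gcongr
        exact hH m
    _ ≤ _ := by
      rw [Finset.sum_const, nsmul_eq_mul]
      have : (Q.support.card : ℝ) ≤ (n + 1) ^ 2 := by exact_mod_cast card_support_le Q hQ
      gcongr

theorem house_det_le {K ι : Type*} [Field K] [NumberField K] [Fintype ι] [DecidableEq ι]
    (a : Matrix ι ι (𝓞 K)) (A : ι → ℝ) (ha : ∀ i j, house (a i j : K) ≤ A i) :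
    house (a.det : K) ≤ (Fintype.card ι).factorial * ∏ i, A i := by
  have hdet : (a.det : K) = ∑ σ : Equiv.Perm ι, ((Equiv.Perm.sign σ : ℤ) : K) *
      ∏ i, (a i (σ i) : K) := by
    rw [← Matrix.det_transpose, Matrix.det_apply']
    simp [map_sum, map_prod]
  rw [hdet]
  refine (house_sum_le_sum_house _ _).trans ?_
  calc _ ≤ ∑ σ : Equiv.Perm ι, ∏ i, A i := by
        refine Finset.sum_le_sum fun σ _ => ?_
        refine (house_mul_le _ _).trans ?_
        have h1 : house (((Equiv.Perm.sign σ : ℤ) : K)) = 1 := by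
          rw [house_intCast]
          rcases Int.units_eq_one_or (Equiv.Perm.sign σ) with h | h <;> simp [h]
        rw [h1, one_mul]
        exact (house_prod_le_prod_house _ _).trans
          (Finset.prod_le_prod (fun _ _ => house_nonneg _) fun i _ => ha _ _)
    _ = _ := by
      rw [Finset.sum_const, nsmul_eq_mul, Finset.card_univ, Fintype.card_perm]

theorem natCast_le_house_of_dvd {K : Type*} [Field K] [NumberField K] {a : 𝓞 K} {n : ℕ}
    (ha : a ≠ 0) (h : (n : 𝓞 K) ∣ a) : (n : ℝ) ≤ house (a : K) := by
  obtain ⟨b, rfl⟩ := h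
  have hb : (b : K) ≠ 0 := by
    rw [Ne, RingOfIntegers.coe_eq_zero_iff]
    exact right_ne_zero_of_mul ha
  have h1 := one_le_house_of_isIntegral b.isIntegral_coe hb
  have : house ((n * b : 𝓞 K) : K) = n * house (b : K) := by
    rw [← house_nat_mul]
    simp
  rw [this]
  exact le_mul_of_one_le_right (Nat.cast_nonneg _) h1

theorem totalDegree_map_of_injective {σ R S : Type*} [CommSemiring R] [CommSemiring S]
    {f : R →+* S} (hf : Function.Injective f) (p : MvPolynomial σ R) :
    (MvPolynomial.map f p).totalDegree = p.totalDegree := by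
  rw [MvPolynomial.totalDegree, MvPolynomial.totalDegree,
    MvPolynomial.support_map_of_injective _ hf]

theorem not_dvd_of_forall_mem_support {k σ : Type*} [Field k] [LinearOrder σ] [WellFoundedGT σ]
    {f g : MvPolynomial σ k} (hg : g ≠ 0)
    (h : ∀ m ∈ g.support, ¬ MonomialOrder.degLex.degree f ≤ m) : ¬ f ∣ g := by
  rintro ⟨r, rfl⟩
  refine h _ (MonomialOrder.degLex.degree_mem_support hg) ?_
  rw [MonomialOrder.degree_mul (left_ne_zero_of_mul hg) (right_ne_zero_of_mul hg)]
  exact le_self_add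

theorem not_dvd_of_totalDegree_lt {k σ : Type*} [Field k]
    {f g : MvPolynomial σ k} (hg : g ≠ 0) (h : g.totalDegree < f.totalDegree) : ¬ f ∣ g :=
  fun hd => h.not_ge (MvPolynomial.totalDegree_le_of_dvd_of_isDomain hd hg)

theorem totalDegree_pderiv_lt {R σ : Type*} [CommSemiring R] (i : σ) {p : MvPolynomial σ R}
    (hp : 0 < p.totalDegree) : (MvPolynomial.pderiv i p).totalDegree < p.totalDegree := by
  refine (Finset.sup_lt_iff (by simpa using hp)).2 fun m hm => ?_
  rw [MvPolynomial.mem_support_iff, MvPolynomial.coeff_pderiv] at hm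
  have h := MvPolynomial.le_totalDegree
    (MvPolynomial.mem_support_iff.2 (left_ne_zero_of_mul hm))
  change (m + Finsupp.single i 1).degree ≤ _ at h
  change m.degree < _
  rw [map_add, Finsupp.degree_single] at h
  omega

theorem totalDegree_eq_one_of_pderiv_eq_zero {k : Type*} [Field k] [IsAlgClosed k] [CharZero k]
    {f : MvPolynomial (Fin 2) k} (hf : Irreducible f) (h : MvPolynomial.pderiv 1 f = 0) :
    f.totalDegree = 1 := by
  have hm : ∀ m ∈ f.support, m 1 = 0 := by
    intro m hm
    by_contra h1
    have hle : Finsupp.single 1 1 ≤ m := by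
      rw [Finsupp.single_le_iff]; omega
    have h2 := MvPolynomial.coeff_pderiv (i := 1) f (m - Finsupp.single 1 1)
    rw [h, tsub_add_cancel_of_le hle, MvPolynomial.coeff_zero, eq_comm] at h2
    rcases mul_eq_zero.1 h2 with h3 | h3
    · exact MvPolynomial.mem_support_iff.1 hm h3
    · exact (Nat.cast_add_one_ne_zero _) h3
  set g : Polynomial k := MvPolynomial.aeval ![Polynomial.X, 0] f with hg
  have hfg : Polynomial.aeval (MvPolynomial.X 0 : MvPolynomial (Fin 2) k) g = f := by
    rw [hg, MvPolynomial.aeval_def, MvPolynomial.eval₂_eq', map_sum]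
    conv_rhs => rw [f.as_sum]
    refine Finset.sum_congr rfl fun m h0 => ?_
    rw [MvPolynomial.monomial_eq, Finsupp.prod_fintype _ _ (by simp), Fin.prod_univ_two]
    simp [hm m h0, Fin.prod_univ_two, MvPolynomial.algebraMap_eq]
  have hdeg : g.degree ≠ 0 := by
    intro h0
    rw [Polynomial.eq_C_of_degree_eq_zero h0] at hfg
    rw [Polynomial.aeval_C, MvPolynomial.algebraMap_eq] at hfg
    refine hf.not_isUnit ?_
    rw [← hfg]
    refine (IsUnit.mk0 _ fun h1 => hf.ne_zero ?_).map _
    rw [← hfg, h1, map_zero]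
  obtain ⟨α, hα⟩ := IsAlgClosed.exists_root g hdeg
  obtain ⟨u, hu⟩ := Polynomial.dvd_iff_isRoot.2 hα
  have h1 : (MvPolynomial.X 0 - MvPolynomial.C α : MvPolynomial (Fin 2) k).totalDegree = 1 := by
    apply le_antisymm
    · refine (MvPolynomial.totalDegree_sub _ _).trans (by simp)
    · have : Finsupp.single (0 : Fin 2) 1 ∈
          (MvPolynomial.X 0 - MvPolynomial.C α : MvPolynomial (Fin 2) k).support := by
        rw [MvPolynomial.mem_support_iff, MvPolynomial.coeff_sub, MvPolynomial.coeff_X,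
          MvPolynomial.coeff_C, if_neg (Finsupp.single_ne_zero.2 one_ne_zero).symm]
        simp
      have h2 := MvPolynomial.le_totalDegree this
      simpa using h2
  have hfac : f = (MvPolynomial.X 0 - MvPolynomial.C α) *
      Polynomial.aeval (MvPolynomial.X 0 : MvPolynomial (Fin 2) k) u := by
    conv_lhs => rw [← hfg, hu]
    simp [MvPolynomial.algebraMap_eq]
  rcases hf.isUnit_or_isUnit hfac with h2 | h2
  · rw [MvPolynomial.isUnit_iff_totalDegree_of_isReduced, h1] at h2
    simp at h2
  · rw [MvPolynomial.isUnit_iff_totalDegree_of_isReduced] at h2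
    have hne := hf.ne_zero
    rw [hfac] at hne ⊢
    rw [MvPolynomial.totalDegree_mul_of_isDomain (left_ne_zero_of_mul hne)
      (right_ne_zero_of_mul hne), h1, h2.2]

theorem algebraMap_ringOfIntegers_algebraicClosure_injective (K : Type*) [Field K]
    [NumberField K] : Function.Injective (algebraMap (𝓞 K) (AlgebraicClosure K)) := by
  rw [IsScalarTower.algebraMap_eq (𝓞 K) K (AlgebraicClosure K)]
  exact (algebraMap K _).injective.comp RingOfIntegers.coe_injective

/-- `G` is an auxiliary polynomial for `F`: it has degree at most `D` and no common factor with
`F` over the algebraic closure. -/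
def IsAuxiliary {K : Type*} [Field K] [NumberField K] (D : ℕ)
    (F G : MvPolynomial (Fin 2) (𝓞 K)) : Prop :=
  G.totalDegree ≤ D ∧
    IsRelPrime (MvPolynomial.map (algebraMap (𝓞 K) (AlgebraicClosure K)) F)
      (MvPolynomial.map (algebraMap (𝓞 K) (AlgebraicClosure K)) G)

theorem map_algebraicClosure_ne_zero {K : Type*} [Field K] [NumberField K]
    {G : MvPolynomial (Fin 2) (𝓞 K)} (hG : G ≠ 0) :
    MvPolynomial.map (algebraMap (𝓞 K) (AlgebraicClosure K)) G ≠ 0 := fun h => hG <|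
  MvPolynomial.map_injective _ (algebraMap_ringOfIntegers_algebraicClosure_injective K)
    (by rw [h, map_zero])

theorem isAuxiliary_pderiv {K : Type*} [Field K] [NumberField K] {D : ℕ}
    {F : MvPolynomial (Fin 2) (𝓞 K)} (h2 : 2 ≤ F.totalDegree) (hD : F.totalDegree ≤ D)
    (hF : Irreducible (MvPolynomial.map (algebraMap (𝓞 K) (AlgebraicClosure K)) F)) :
    IsAuxiliary D F (MvPolynomial.pderiv 1 F) := by
  have hinj := algebraMap_ringOfIntegers_algebraicClosure_injective K
  refine ⟨(totalDegree_pderiv_lt 1 (by omega)).le.trans hD, hF.isRelPrime_iff_not_dvd.2 ?_⟩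
  have : CharZero (AlgebraicClosure K) := charZero_of_injective_algebraMap
    (algebraMap K (AlgebraicClosure K)).injective
  rw [← MvPolynomial.pderiv_map]
  refine not_dvd_of_totalDegree_lt (fun h => ?_) (totalDegree_pderiv_lt 1 ?_)
  · have h1 := totalDegree_eq_one_of_pderiv_eq_zero hF h
    rw [totalDegree_map_of_injective hinj] at h1
    omega
  · rw [totalDegree_map_of_injective hinj]
    omega

theorem exists_polynomial_of_coeff {R : Type*} [CommRing R] {E : Finset (Fin 2 →₀ ℕ)}
    {ξ : E → R} (hξ : ξ ≠ 0) :
    ∃ G : MvPolynomial (Fin 2) R, G ≠ 0 ∧ G.support ⊆ E ∧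
      (∀ x, MvPolynomial.eval x G = ∑ m, ξ m * MvPolynomial.eval x (MvPolynomial.monomial m 1)) ∧
      ∀ m, G.coeff m = 0 ∨ ∃ l, G.coeff m = ξ l := by
  classical
  set G : MvPolynomial (Fin 2) R := ∑ m : E, MvPolynomial.monomial (m : Fin 2 →₀ ℕ) (ξ m) with hG
  have hcoeff (m : E) : G.coeff m = ξ m := by
    rw [hG, MvPolynomial.coeff_sum, Finset.sum_eq_single m]
    · simp
    · intro l _ hl
      rw [MvPolynomial.coeff_monomial, if_neg fun h => hl (Subtype.ext h)]
    · simp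
  have hcoeff' (m) (hm : m ∉ E) : G.coeff m = 0 := by
    rw [hG, MvPolynomial.coeff_sum]
    refine Finset.sum_eq_zero fun l _ => ?_
    rw [MvPolynomial.coeff_monomial, if_neg]
    rintro rfl
    exact hm l.2
  refine ⟨G, fun h => hξ ?_, fun m hm => ?_, fun x => ?_, fun m => ?_⟩
  · ext l
    rw [← hcoeff, h, MvPolynomial.coeff_zero, Pi.zero_apply]
  · by_contra h
    exact MvPolynomial.mem_support_iff.1 hm (hcoeff' m h)
  · rw [hG, map_sum]
    simp [MvPolynomial.eval_monomial]
  · by_cases h : m ∈ E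
    · exact Or.inr ⟨⟨m, h⟩, hcoeff ⟨m, h⟩⟩
    · exact Or.inl (hcoeff' m h)

theorem exists_isAuxiliary_of_congr {K : Type*} [Field K] [NumberField K] {D : ℕ}
    {F : MvPolynomial (Fin 2) (𝓞 K)} (h2 : 2 ≤ F.totalDegree) (hD : F.totalDegree ≤ D)
    (hF : Irreducible (MvPolynomial.map (algebraMap (𝓞 K) (AlgebraicClosure K)) F))
    {B : ℝ} (hB : 1 ≤ B) {q : ℕ}
    (hq : (((D + 1) ^ 2).factorial : ℝ) * B ^ (1 / (F.totalDegree : ℝ) + 2 / (D : ℝ)) < q)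
    {T : Set (Fin 2 → 𝓞 K)}
    (hT : ∀ x ∈ T, MvPolynomial.eval x F = 0 ∧ ∀ k, house (x k : K) ≤ B)
    {x₀ : Fin 2 → 𝓞 K} {w : 𝓞 K} (hx₀ : ∀ x ∈ T, ∀ k, (q : 𝓞 K) ∣ x k - x₀ k)
    (hw : (q : 𝓞 K) ∣ w * MvPolynomial.eval x₀ (MvPolynomial.pderiv 1 F) - 1) :
    ∃ G, IsAuxiliary D F G ∧ ∀ x ∈ T, MvPolynomial.eval x G = 0 := by
  classical
  have hinj := algebraMap_ringOfIntegers_algebraicClosure_injective K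
  set F' := MvPolynomial.map (algebraMap (𝓞 K) (AlgebraicClosure K)) F with hF'
  have he : (MonomialOrder.degLex.degree F').degree = F.totalDegree := by
    rw [MvPolynomial.degree_degLexDegree, totalDegree_map_of_injective hinj]
  obtain ⟨E, hE, hEcard, hE2, hW⟩ := exists_monomials (MonomialOrder.degLex.degree F') D
    (by rwa [he]) (by rwa [he])
  rw [he] at hW
  have hone : house ((1 : 𝓞 K) : K) = 1 := by simpa using house_intCast (K := K) 1
  have hmon (x) (hx : x ∈ T) (m : Fin 2 →₀ ℕ) :
      house (MvPolynomial.eval x (MvPolynomial.monomial m 1) : K) ≤ B ^ m.degree := by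
    have h := house_eval_monomial_le (hT x hx).2 m 1
    rwa [hone, one_mul] at h
  obtain ⟨C, -, hC⟩ := exists_det_ne_zero_or_exists_relation K
  rcases hC E (Fin 2 → 𝓞 K) T (fun x m => MvPolynomial.eval x (MvPolynomial.monomial m 1))
    (B ^ D) (one_le_pow₀ hB)
    (fun x hx m => (hmon x hx m).trans (pow_le_pow_right₀ hB (hE m m.2).1)) with
    ⟨f, hfT, hdet⟩ | ⟨ξ, hξ, hξT, -⟩
  · exfalso
    set a : Matrix E E (𝓞 K) := Matrix.of fun i j =>
      MvPolynomial.eval (f j) (MvPolynomial.monomial (i : Fin 2 →₀ ℕ) 1) with ha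
    set s := E.card
    set t := s * (s - 1) / 2
    have hdvd : (q : 𝓞 K) ^ t ∣ a.det := by
      rw [← Matrix.det_submatrix_equiv_self E.equivFin.symm a]
      exact pow_dvd_det_eval (x := fun i => f (E.equivFin.symm i)) (fun i => (hT _ (hfT _)).1)
        (fun i k => hx₀ _ (hfT _) k) hw
        fun i => MvPolynomial.monomial (E.equivFin.symm i : Fin 2 →₀ ℕ) 1
    have h1 : ((q ^ t : ℕ) : ℝ) ≤ house (a.det : K) :=
      natCast_le_house_of_dvd hdet (by exact_mod_cast hdvd)
    have h3 := house_det_le a (fun m => B ^ (m : Fin 2 →₀ ℕ).degree) fun i j => hmon _ (hfT j) i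
    have ht : t ≠ 0 := by
      have : 2 ≤ s * (s - 1) := by nlinarith [show 1 ≤ s - 1 by omega]
      omega
    have hsum : ∏ m : E, B ^ (m : Fin 2 →₀ ℕ).degree = B ^ ((∑ m ∈ E, m.degree : ℕ) : ℝ) := by
      rw [Finset.prod_pow_eq_pow_sum, Real.rpow_natCast, Finset.sum_coe_sort E fun m => m.degree]
    rw [hsum, Fintype.card_coe] at h3
    have hfac : (s.factorial : ℝ) ≤ (((D + 1) ^ 2).factorial : ℝ) ^ t :=
      (by exact_mod_cast Nat.factorial_le hEcard :
        (s.factorial : ℝ) ≤ (((D + 1) ^ 2).factorial : ℝ)).trans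
        (le_self_pow₀ (by exact_mod_cast Nat.one_le_iff_ne_zero.2 (Nat.factorial_ne_zero _)) ht)
    refine lt_irrefl ((q ^ t : ℕ) : ℝ) ((h1.trans h3).trans_lt ?_)
    calc _ ≤ (((D + 1) ^ 2).factorial : ℝ) ^ t *
            B ^ ((t : ℝ) * (1 / (F.totalDegree : ℝ) + 2 / (D : ℝ))) := by gcongr
      _ = ((((D + 1) ^ 2).factorial : ℝ) * B ^ (1 / (F.totalDegree : ℝ) + 2 / (D : ℝ))) ^ t := by
        rw [mul_pow, mul_comm (t : ℝ), Real.rpow_mul_natCast (by linarith)]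
      _ < (q : ℝ) ^ t := pow_lt_pow_left₀ hq (by positivity) ht
      _ = _ := by push_cast; rfl
  · obtain ⟨G, hG0, hGE, hGeval, -⟩ := exists_polynomial_of_coeff hξ
    refine ⟨G, ⟨?_, hF.isRelPrime_iff_not_dvd.2 ?_⟩, fun x hx => ?_⟩
    · exact Finset.sup_le fun m hm => (hE m (hGE hm)).1
    · refine not_dvd_of_forall_mem_support (map_algebraicClosure_ne_zero hG0) fun m hm => ?_
      exact (hE m (hGE (MvPolynomial.support_map_subset _ _ hm))).2
    · rw [hGeval]
      exact hξT x hx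

theorem totalDegree_map_le {σ R S : Type*} [CommSemiring R] [CommSemiring S] (f : R →+* S)
    (p : MvPolynomial σ R) : (MvPolynomial.map f p).totalDegree ≤ p.totalDegree :=
  Finset.sup_mono (MvPolynomial.support_map_subset f p)

theorem exists_finset_cover_of_residues {A R : Type*} [CommRing A] [CommRing R] [Finite R]
    {mk : A →+* R} (hmk : Function.Surjective mk) {q : A} (hq : ∀ a, q ∣ a ↔ mk a = 0)
    {F : MvPolynomial (Fin 2) A} {P : MvPolynomial (Fin 2) A → Prop} {T : Set (Fin 2 → A)}
    (hT : ∀ x ∈ T, MvPolynomial.eval x F = 0)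
    (h : ∀ (x₀ : Fin 2 → A) (w : A),
      q ∣ w * MvPolynomial.eval x₀ (MvPolynomial.pderiv 1 F) - 1 →
      ∃ G, P G ∧ ∀ x ∈ T, (∀ k, q ∣ x k - x₀ k) → MvPolynomial.eval x G = 0) :
    ∃ S : Finset (MvPolynomial (Fin 2) A),
      S.card ≤ {z : Fin 2 → R | MvPolynomial.eval z (MvPolynomial.map mk F) = 0 ∧
        IsUnit (MvPolynomial.eval z (MvPolynomial.pderiv 1 (MvPolynomial.map mk F)))}.ncard ∧
      (∀ G ∈ S, P G) ∧
      ∀ x ∈ T, (∃ w, q ∣ w * MvPolynomial.eval x (MvPolynomial.pderiv 1 F) - 1) →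
        ∃ G ∈ S, MvPolynomial.eval x G = 0 := by
  classical
  have heval (x : Fin 2 → A) (Q : MvPolynomial (Fin 2) A) :
      MvPolynomial.eval (mk ∘ x) (MvPolynomial.map mk Q) = mk (MvPolynomial.eval x Q) := by
    rw [MvPolynomial.eval_map]
    simp [MvPolynomial.eval₂_eq', MvPolynomial.eval_eq']
  set Z := {z : Fin 2 → R | MvPolynomial.eval z (MvPolynomial.map mk F) = 0 ∧
    IsUnit (MvPolynomial.eval z (MvPolynomial.pderiv 1 (MvPolynomial.map mk F)))} with hZdef
  have hZfin : Z.Finite := Set.toFinite _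
  have key : ∀ z : Fin 2 → R, ∃ G, z ∈ Z → P G ∧
      ∀ x ∈ T, mk ∘ x = z → MvPolynomial.eval x G = 0 := by
    intro z
    by_cases hz : z ∈ Z
    swap
    · exact ⟨0, fun h => absurd h hz⟩
    choose x₀ hx₀ using fun k => hmk (z k)
    have hx₀' : mk ∘ x₀ = z := funext hx₀
    obtain ⟨u, hu⟩ := hz.2.exists_left_inv
    obtain ⟨w, rfl⟩ := hmk u
    obtain ⟨G, hG, hGT⟩ := h x₀ w (by
      rw [hq, map_sub, map_mul, ← heval, hx₀', ← MvPolynomial.pderiv_map, hu, map_one, sub_self])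
    refine ⟨G, fun _ => ⟨hG, fun x hx hxz => hGT x hx fun k => ?_⟩⟩
    rw [hq, map_sub, sub_eq_zero]
    exact (congrFun hxz k).trans (hx₀ k).symm
  choose g hg using key
  refine ⟨hZfin.toFinset.image g, ?_, ?_, ?_⟩
  · rw [Set.ncard_eq_toFinset_card Z hZfin]
    exact Finset.card_image_le
  · intro G hG
    obtain ⟨z, hz, rfl⟩ := Finset.mem_image.1 hG
    exact (hg z (hZfin.mem_toFinset.1 hz)).1
  · rintro x hx ⟨w, hw⟩
    have hz : mk ∘ x ∈ Z := by
      refine ⟨by rw [heval, hT x hx, map_zero], ?_⟩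
      rw [MvPolynomial.pderiv_map, heval]
      rw [hq, map_sub, map_mul, map_one, sub_eq_zero] at hw
      exact IsUnit.of_mul_eq_one_right _ hw
    exact ⟨g (mk ∘ x), Finset.mem_image_of_mem _ (hZfin.mem_toFinset.2 hz), (hg _ hz).2 x hx rfl⟩

theorem exists_finset_isAuxiliary_of_prime {K : Type*} [Field K] [NumberField K] {D : ℕ}
    {F : MvPolynomial (Fin 2) (𝓞 K)} (h2 : 2 ≤ F.totalDegree) (hD : F.totalDegree ≤ D)
    (hF : Irreducible (MvPolynomial.map (algebraMap (𝓞 K) (AlgebraicClosure K)) F))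
    {B : ℝ} (hB : 1 ≤ B) {q : ℕ} (hqp : q.Prime)
    (hq : (((D + 1) ^ 2).factorial : ℝ) * B ^ (1 / (F.totalDegree : ℝ) + 2 / (D : ℝ)) < q) :
    ∃ S : Finset (MvPolynomial (Fin 2) (𝓞 K)),
      S.card ≤ F.totalDegree ^ Module.finrank ℚ K * q ^ Module.finrank ℚ K ∧
      (∀ G ∈ S, IsAuxiliary D F G) ∧
      ∀ x : Fin 2 → 𝓞 K, MvPolynomial.eval x F = 0 → (∀ k, house (x k : K) ≤ B) →
        (∃ w, (q : 𝓞 K) ∣ w * MvPolynomial.eval x (MvPolynomial.pderiv 1 F) - 1) →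
        ∃ G ∈ S, MvPolynomial.eval x G = 0 := by
  have hcard := natCard_quotient_span_natCast K q
  have hfin : Finite (𝓞 K ⧸ Ideal.span {(q : 𝓞 K)}) := Nat.finite_of_card_ne_zero
    (by rw [hcard]; exact pow_ne_zero _ hqp.ne_zero)
  have hdvd (a : 𝓞 K) : (q : 𝓞 K) ∣ a ↔ Ideal.Quotient.mk (Ideal.span {(q : 𝓞 K)}) a = 0 := by
    rw [Ideal.Quotient.eq_zero_iff_mem, Ideal.mem_span_singleton]
  obtain ⟨S, hS, hSP, hST⟩ := exists_finset_cover_of_residues Ideal.Quotient.mk_surjective hdvd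
    (F := F) (P := IsAuxiliary D F)
    (T := {x | MvPolynomial.eval x F = 0 ∧ ∀ k, house (x k : K) ≤ B}) (fun x hx => hx.1)
    fun x₀ w hw => by
      obtain ⟨G, hG, hGT⟩ := exists_isAuxiliary_of_congr h2 hD hF hB hq
        (T := {x | (MvPolynomial.eval x F = 0 ∧ ∀ k, house (x k : K) ≤ B) ∧
          ∀ k, (q : 𝓞 K) ∣ x k - x₀ k}) (fun x hx => hx.1) (fun x hx => hx.2) hw
      exact ⟨G, hG, fun x hx hxq => hGT x ⟨hx, hxq⟩⟩
  have hq0 : ((q : ℕ) : 𝓞 K ⧸ Ideal.span {(q : 𝓞 K)}) = 0 := by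
    rw [← map_natCast (Ideal.Quotient.mk (Ideal.span {(q : 𝓞 K)})), ← hdvd]
  have hdeg : (MvPolynomial.map (Ideal.Quotient.mk (Ideal.span {(q : 𝓞 K)})) F).totalDegree ≤
      F.totalDegree :=
    totalDegree_map_le _ F
  have hZ := ncard_simple_zeros_le _ (one_le_two.trans h2) hdeg hqp hq0 hcard
  exact ⟨S, hS.trans hZ, hSP, fun x hx hxB => hST x ⟨hx, hxB⟩⟩

theorem exists_finset_primes {M : ℕ} (hM : M ≠ 0) (r : ℕ) :
    ∃ P : Finset ℕ, P.card = r ∧ ∀ q ∈ P, q.Prime ∧ M < q ∧ q ≤ 2 ^ r * M := by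
  induction r with
  | zero => exact ⟨∅, by simp⟩
  | succ r ih =>
    obtain ⟨P, hP, hPq⟩ := ih
    have h1 : 1 ≤ 2 ^ r := Nat.one_le_two_pow
    obtain ⟨q, hq, hlt, hle⟩ := Nat.exists_prime_lt_and_le_two_mul (2 ^ r * M) (by positivity)
    refine ⟨insert q P, ?_, ?_⟩
    · rw [Finset.card_insert_of_notMem fun h => hlt.not_ge (hPq q h).2.2, hP]
    · intro p hp
      rcases Finset.mem_insert.1 hp with rfl | hp
      · exact ⟨hq, (Nat.le_mul_of_pos_left M h1).trans_lt hlt, by rw [pow_succ]; linarith⟩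
      · refine ⟨(hPq p hp).1, (hPq p hp).2.1, (hPq p hp).2.2.trans ?_⟩
        gcongr <;> simp

theorem exists_prime_not_dvd {P : Finset ℕ} {M n : ℕ} (hP : ∀ q ∈ P, q.Prime ∧ M < q)
    (hn : n ≠ 0) (h : n < M ^ P.card) : ∃ q ∈ P, ¬ q ∣ n := by
  by_contra! hall
  have h1 : ∏ q ∈ P, q ≤ n := Nat.le_of_dvd (Nat.pos_of_ne_zero hn)
    (Finset.prod_primes_dvd n (fun q hq => (hP q hq).1.prime) hall)
  have h2 : M ^ P.card ≤ ∏ q ∈ P, q := Finset.pow_card_le_prod P _ M fun q hq => (hP q hq).2.le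
  omega

theorem house_eval_pderiv_le {K : Type*} [Field K] [NumberField K] {x : Fin 2 → 𝓞 K} {B H : ℝ}
    (hB : 1 ≤ B) (hx : ∀ i, house (x i : K) ≤ B) {F : MvPolynomial (Fin 2) (𝓞 K)}
    (hH : ∀ m, house ((F.coeff m : 𝓞 K) : K) ≤ H) (i : Fin 2) :
    house (MvPolynomial.eval x (MvPolynomial.pderiv i F) : K) ≤
      (F.totalDegree + 1) ^ 2 * (F.totalDegree * H * B ^ F.totalDegree) := by
  have hH0 : 0 ≤ H := (house_nonneg _).trans (hH 0)
  have hzero : house ((0 : 𝓞 K) : K) = 0 := by simpa using house_intCast (K := K) 0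
  refine house_eval_le hB hx ?_ fun m => ?_
  · rcases Nat.eq_zero_or_pos F.totalDegree with h | h
    · rw [MvPolynomial.totalDegree_eq_zero_iff_eq_C.1 h]
      simp
    · exact (totalDegree_pderiv_lt i h).le
  · rw [MvPolynomial.coeff_pderiv]
    by_cases h : F.coeff (m + Finsupp.single i 1) = 0
    · rw [h, zero_mul, hzero]
      positivity
    · have hdeg : m i + 1 ≤ F.totalDegree := by
        have h1 := MvPolynomial.le_totalDegree (MvPolynomial.mem_support_iff.2 h)
        have h2 := Finsupp.le_degree i (m + Finsupp.single i 1)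
        change (m + Finsupp.single i 1).degree ≤ _ at h1
        simp only [Finsupp.add_apply, Finsupp.single_eq_same] at h2
        exact h2.trans h1
      have hcast : ((F.coeff (m + Finsupp.single i 1) * (m i + 1) : 𝓞 K) : K) =
          ((m i + 1 : ℕ) : K) * ((F.coeff (m + Finsupp.single i 1) : 𝓞 K) : K) := by
        rw [mul_comm]
        push_cast
        rfl
      rw [hcast, house_nat_mul]
      have : ((m i + 1 : ℕ) : ℝ) ≤ F.totalDegree := by exact_mod_cast hdeg
      gcongr
      · exact house_nonneg _
      · exact hH _

theorem exists_cover_of_house_coeff_le (K : Type*) [Field K] [NumberField K] {d D : ℕ} (A : ℕ)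
    (hd : 2 ≤ d) (hD : d ≤ D) :
    ∃ B₀ : ℝ, 1 ≤ B₀ ∧ ∀ F : MvPolynomial (Fin 2) (𝓞 K), F.totalDegree = d →
      Irreducible (MvPolynomial.map (algebraMap (𝓞 K) (AlgebraicClosure K)) F) →
      ∀ B : ℝ, B₀ ≤ B → (∀ m, house ((F.coeff m : 𝓞 K) : K) ≤ B ^ A) →
        ∃ S : Finset (MvPolynomial (Fin 2) (𝓞 K)), S.Nonempty ∧ (∀ G ∈ S, IsAuxiliary D F G) ∧
          (∀ x : Fin 2 → 𝓞 K, MvPolynomial.eval x F = 0 → (∀ k, house (x k : K) ≤ B) →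
            ∃ G ∈ S, MvPolynomial.eval x G = 0) ∧
          (S.card : ℝ) ≤ B ^ ((Module.finrank ℚ K : ℝ) * (1 / (d : ℝ) + 6 / (D : ℝ))) := by
  classical
  set ρ := Module.finrank ℚ K with hρ
  have hρ1 : 1 ≤ ρ := Module.finrank_pos
  set N := ((D + 1) ^ 2).factorial with hN
  have hN1 : (1 : ℝ) ≤ N := by exact_mod_cast Nat.one_le_iff_ne_zero.2 (Nat.factorial_ne_zero _)
  set r := d * ((A + d + 1) * ρ + 1) with hr
  set C : ℝ := 1 + r * (d ^ ρ * (2 ^ r * (2 * N)) ^ ρ) with hC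
  have hC1 : 1 ≤ C := le_add_of_nonneg_right (by positivity)
  have hd0 : (0 : ℝ) < d := by exact_mod_cast (by omega : 0 < d)
  have hD0 : (0 : ℝ) < D := by exact_mod_cast (by omega : 0 < D)
  refine ⟨max ((d + 1) ^ 3) (C ^ D), le_max_of_le_right (one_le_pow₀ hC1), ?_⟩
  rintro F rfl hF B hB hH
  set d := F.totalDegree with hdF
  have hBd : ((d : ℝ) + 1) ^ 3 ≤ B := (le_max_left _ _).trans hB
  have hBC : C ^ D ≤ B := (le_max_right _ _).trans hB
  have hB1' : 1 < B := (one_lt_pow₀ (by linarith) (by norm_num)).trans_le hBd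
  have hB1 : 1 ≤ B := hB1'.le
  have hB0 : 0 < B := by linarith
  set θ : ℝ := 1 / (d : ℝ) + 2 / (D : ℝ) with hθ
  have hθ0 : 0 ≤ θ := by positivity
  have hBθ : 1 ≤ B ^ θ := Real.one_le_rpow hB1 hθ0
  set M := ⌈N * B ^ θ⌉₊ with hM
  have hMle : (N : ℝ) * B ^ θ ≤ M := Nat.le_ceil _
  have hNB : 1 ≤ (N : ℝ) * B ^ θ := one_le_mul_of_one_le_of_one_le hN1 hBθ
  have hM2 : (M : ℝ) ≤ 2 * N * B ^ θ := by
    have := (Nat.ceil_lt_add_one (zero_le_one.trans hNB)).le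
    rw [← hM] at this
    linarith
  have hM0 : M ≠ 0 := by
    rintro h
    rw [h, Nat.cast_zero] at hMle
    linarith
  obtain ⟨P, hPcard, hP⟩ := exists_finset_primes hM0 r
  have hPlt (q) (hq : q ∈ P) : (N : ℝ) * B ^ θ < q :=
    hMle.trans_lt (by exact_mod_cast (hP q hq).2.1)
  choose! S hScard hSaux hScov using fun q (hq : q ∈ P) =>
    exists_finset_isAuxiliary_of_prime hd hD hF hB1 (hP q hq).1 (hPlt q hq)
  refine ⟨insert (MvPolynomial.pderiv 1 F) (P.biUnion S), Finset.insert_nonempty _ _, ?_, ?_, ?_⟩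
  · intro G hG
    rcases Finset.mem_insert.1 hG with rfl | hG
    · exact isAuxiliary_pderiv hd hD hF
    · obtain ⟨q, hq, hGq⟩ := Finset.mem_biUnion.1 hG
      exact hSaux q hq G hGq
  · intro x hx hxB
    by_cases hy : MvPolynomial.eval x (MvPolynomial.pderiv 1 F) = 0
    · exact ⟨_, Finset.mem_insert_self _ _, hy⟩
    obtain ⟨n, hn0, hyn, hn⟩ := exists_dvd_natCast K hy
    have hhouse : house (MvPolynomial.eval x (MvPolynomial.pderiv 1 F) : K) ≤ B ^ (A + d + 1) := by
      refine (house_eval_pderiv_le hB1 hxB hH 1).trans ?_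
      calc ((d : ℝ) + 1) ^ 2 * (d * B ^ A * B ^ d)
          ≤ ((d : ℝ) + 1) ^ 2 * ((d + 1) * B ^ A * B ^ d) := by gcongr; linarith
        _ = ((d : ℝ) + 1) ^ 3 * (B ^ A * B ^ d) := by ring
        _ ≤ B * (B ^ A * B ^ d) := by gcongr
        _ = _ := by ring
    have hBM : B ≤ (M : ℝ) ^ d := by
      calc B = (B ^ (1 / (d : ℝ))) ^ d := by
            rw [← Real.rpow_mul_natCast hB0.le, one_div, inv_mul_cancel₀ hd0.ne', Real.rpow_one]
        _ ≤ (B ^ θ) ^ d := by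
          gcongr
          exact le_add_of_nonneg_right (by positivity)
        _ ≤ (M : ℝ) ^ d := by
          gcongr
          exact (le_mul_of_one_le_left (by positivity) hN1).trans hMle
    have hnM : n < M ^ P.card := by
      have : (n : ℝ) < (M : ℝ) ^ r := by
        calc (n : ℝ) ≤ (B ^ (A + d + 1)) ^ ρ :=
              hn.trans (pow_le_pow_left₀ (house_nonneg _) hhouse _)
          _ = B ^ ((A + d + 1) * ρ) := by rw [pow_mul]
          _ < B ^ ((A + d + 1) * ρ + 1) := pow_lt_pow_right₀ hB1' (Nat.lt_succ_self _)
          _ ≤ ((M : ℝ) ^ d) ^ ((A + d + 1) * ρ + 1) := pow_le_pow_left₀ hB0.le hBM _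
          _ = _ := by rw [hr, pow_mul]
      rw [hPcard]
      exact_mod_cast this
    obtain ⟨q, hq, hqn⟩ := exists_prime_not_dvd (fun q hq => ⟨(hP q hq).1, (hP q hq).2.1⟩) hn0 hnM
    have hw : ∃ w, (q : 𝓞 K) ∣ w * MvPolynomial.eval x (MvPolynomial.pderiv 1 F) - 1 := by
      obtain ⟨a, b, hab⟩ := Nat.isCoprime_iff_coprime.2 (((hP q hq).1.coprime_iff_not_dvd).2 hqn)
      obtain ⟨c, hc⟩ := hyn
      have hab' : (a : 𝓞 K) * q + b * n = 1 := by exact_mod_cast congrArg (Int.cast (R := 𝓞 K)) hab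
      exact ⟨b * c, -a, by linear_combination hab' - (b : 𝓞 K) * hc⟩
    obtain ⟨G, hG, hGx⟩ := hScov q hq x hx hxB hw
    exact ⟨G, Finset.mem_insert_of_mem (Finset.mem_biUnion.2 ⟨q, hq, hG⟩), hGx⟩
  · have hcard : ((insert (MvPolynomial.pderiv 1 F) (P.biUnion S)).card : ℝ) ≤
        r * (d ^ ρ * (2 ^ r * M) ^ ρ) + 1 := by
      have h1 : (insert (MvPolynomial.pderiv 1 F) (P.biUnion S)).card ≤
          r * (d ^ ρ * (2 ^ r * M) ^ ρ) + 1 := by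
        refine (Finset.card_insert_le _ _).trans (Nat.add_le_add_right ?_ 1)
        rw [← hPcard]
        refine Finset.card_biUnion_le_card_mul _ _ _ fun q hq => (hScard q hq).trans ?_
        rw [hPcard]
        gcongr
        exact (hP q hq).2.2
      exact_mod_cast h1
    have hBθρ : 1 ≤ (B ^ θ) ^ ρ := one_le_pow₀ hBθ
    calc _ ≤ r * (d ^ ρ * (2 ^ r * (M : ℝ)) ^ ρ) + 1 := hcard
      _ ≤ r * (d ^ ρ * (2 ^ r * (2 * N * B ^ θ)) ^ ρ) + (B ^ θ) ^ ρ := by gcongr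
      _ = C * (B ^ θ) ^ ρ := by
        rw [hC]
        simp only [mul_pow]
        ring
      _ ≤ B ^ ((ρ : ℝ) * (4 / (D : ℝ))) * (B ^ θ) ^ ρ := by
        gcongr
        calc C = (C ^ D) ^ (1 / (D : ℝ)) := by
              rw [← Real.rpow_natCast, ← Real.rpow_mul (by linarith), mul_one_div_cancel hD0.ne',
                Real.rpow_one]
          _ ≤ B ^ (1 / (D : ℝ)) := Real.rpow_le_rpow (by positivity) hBC (by positivity)
          _ ≤ B ^ ((ρ : ℝ) * (4 / (D : ℝ))) := by
            refine Real.rpow_le_rpow_of_exponent_le hB1 ?_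
            have : (1 : ℝ) ≤ ρ := by exact_mod_cast hρ1
            calc 1 / (D : ℝ) ≤ 1 * (4 / (D : ℝ)) := by rw [one_mul]; gcongr; norm_num
              _ ≤ _ := by gcongr
      _ = _ := by
        rw [← Real.rpow_mul_natCast hB0.le, ← Real.rpow_add hB0]
        congr 1
        rw [hθ]
        ring

/-- Nonzero polynomials of bounded degree and bounded height that vanish on all the zeros of `F`
of bounded house. -/
theorem exists_house_coeff_le_of_box (K : Type*) [Field K] [NumberField K] (d : ℕ) :
    ∃ (A : ℕ) (B₀ : ℝ), ∀ F : MvPolynomial (Fin 2) (𝓞 K), F ≠ 0 → F.totalDegree ≤ d →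
      ∀ B : ℝ, 1 ≤ B → B₀ ≤ B →
        ∃ G : MvPolynomial (Fin 2) (𝓞 K), G ≠ 0 ∧ G.totalDegree ≤ d ∧
          (∀ m, house ((G.coeff m : 𝓞 K) : K) ≤ B ^ A) ∧
          ∀ x : Fin 2 → 𝓞 K, MvPolynomial.eval x F = 0 → (∀ k, house (x k : K) ≤ B) →
            MvPolynomial.eval x G = 0 := by
  classical
  set E : Finset (Fin 2 →₀ ℕ) := (Finsupp.finite_of_degree_le d).toFinset with hEdef
  have hE (m) : m ∈ E ↔ m.degree ≤ d := Set.Finite.mem_toFinset _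
  set n := E.card
  obtain ⟨C, hC1, hC⟩ := exists_det_ne_zero_or_exists_relation K
  refine ⟨d * n + 1, C * (C * n) ^ n, fun F hF hFd B hB1 hB => ?_⟩
  have hone : house ((1 : 𝓞 K) : K) = 1 := by simpa using house_intCast (K := K) 1
  have hzero : house ((0 : 𝓞 K) : K) = 0 := by simpa using house_intCast (K := K) 0
  have hsupp : F.support ⊆ E := fun m hm =>
    (hE m).2 ((MvPolynomial.le_totalDegree hm).trans hFd)
  rcases hC E (Fin 2 → 𝓞 K) {x | MvPolynomial.eval x F = 0 ∧ ∀ k, house (x k : K) ≤ B}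
    (fun x m => MvPolynomial.eval x (MvPolynomial.monomial m 1)) (B ^ d) (one_le_pow₀ hB1)
    (fun x hx m => by
      have h := house_eval_monomial_le hx.2 m 1
      rw [hone, one_mul] at h
      exact h.trans (pow_le_pow_right₀ hB1 ((hE m).1 m.2))) with
    ⟨f, hf, hdet⟩ | ⟨ξ, hξ, hξT, hξB⟩
  · refine absurd (Matrix.exists_vecMul_eq_zero_iff.1 ⟨fun m : E => F.coeff m, ?_, ?_⟩) hdet
    · intro h
      obtain ⟨m, hm⟩ := MvPolynomial.support_nonempty.2 hF
      exact MvPolynomial.mem_support_iff.1 hm (congrFun h ⟨m, hsupp hm⟩)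
    · ext1 j
      have h := (hf j).1
      rw [F.as_sum, map_sum, Finset.sum_subset hsupp fun m _ hm => by
        rw [MvPolynomial.notMem_support_iff.1 hm, map_zero, map_zero],
        ← Finset.sum_coe_sort E fun m => MvPolynomial.eval (f j)
          (MvPolynomial.monomial m (F.coeff m))] at h
      rw [Pi.zero_apply, ← h]
      simp [Matrix.vecMul, dotProduct, MvPolynomial.eval_monomial]
  · obtain ⟨G, hG0, hGE, hGeval, hGcoeff⟩ := exists_polynomial_of_coeff hξ
    refine ⟨G, hG0, Finset.sup_le fun m hm => (hE m).1 (hGE hm), fun m => ?_, fun x hx hxB => ?_⟩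
    · rcases hGcoeff m with h | ⟨l, h⟩
      · rw [h, hzero]
        positivity
      · rw [h]
        refine (hξB l).trans ?_
        rw [Fintype.card_coe]
        calc C * (C * n * B ^ d) ^ n = C * (C * n) ^ n * B ^ (d * n) := by
              rw [mul_pow _ (B ^ d), pow_mul]; ring
          _ ≤ B * B ^ (d * n) := by gcongr
          _ = _ := by ring
    · rw [hGeval]
      exact hξT x ⟨hx, hxB⟩

theorem exists_cover (K : Type*) [Field K] [NumberField K] {d D : ℕ}
    (hd : 2 ≤ d) (hD : d ≤ D) :
    ∃ B₀ : ℝ, 1 ≤ B₀ ∧ ∀ F : MvPolynomial (Fin 2) (𝓞 K), F.totalDegree = d →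
      Irreducible (MvPolynomial.map (algebraMap (𝓞 K) (AlgebraicClosure K)) F) →
      ∀ B : ℝ, B₀ ≤ B →
        ∃ S : Finset (MvPolynomial (Fin 2) (𝓞 K)), S.Nonempty ∧ (∀ G ∈ S, IsAuxiliary D F G) ∧
          (∀ x : Fin 2 → 𝓞 K, MvPolynomial.eval x F = 0 → (∀ k, house (x k : K) ≤ B) →
            ∃ G ∈ S, MvPolynomial.eval x G = 0) ∧
          (S.card : ℝ) ≤ B ^ ((Module.finrank ℚ K : ℝ) * (1 / (d : ℝ) + 6 / (D : ℝ))) := by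
  have hinj := algebraMap_ringOfIntegers_algebraicClosure_injective K
  obtain ⟨A, B₁, hG⟩ := exists_house_coeff_le_of_box K d
  obtain ⟨B₂, hB₂, hS⟩ := exists_cover_of_house_coeff_le K A hd hD
  refine ⟨max B₁ B₂, le_max_of_le_right hB₂, fun F hFd hF B hB => ?_⟩
  have hB1 : 1 ≤ B := hB₂.trans ((le_max_right _ _).trans hB)
  have hF0 : F ≠ 0 := by
    rintro rfl
    rw [MvPolynomial.totalDegree_zero] at hFd
    omega
  obtain ⟨G, hG0, hGd, hGH, hGF⟩ := hG F hF0 hFd.le B hB1 ((le_max_left _ _).trans hB)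
  by_cases hdvd : MvPolynomial.map (algebraMap (𝓞 K) (AlgebraicClosure K)) F ∣
    MvPolynomial.map (algebraMap (𝓞 K) (AlgebraicClosure K)) G
  · obtain ⟨u, hu⟩ := hdvd
    have hne := map_algebraicClosure_ne_zero hG0
    rw [hu] at hne
    have hdeg := congrArg MvPolynomial.totalDegree hu
    rw [MvPolynomial.totalDegree_mul_of_isDomain (left_ne_zero_of_mul hne)
      (right_ne_zero_of_mul hne), totalDegree_map_of_injective hinj,
      totalDegree_map_of_injective hinj] at hdeg
    have hu0 : u.totalDegree = 0 := by omega
    have hunit : IsUnit u := by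
      have hC := MvPolynomial.totalDegree_eq_zero_iff_eq_C.1 hu0
      have hne' := right_ne_zero_of_mul hne
      rw [hC] at hne' ⊢
      exact (IsUnit.mk0 _ fun h => hne' (by rw [h, map_zero])).map _
    have hGirr : Irreducible (MvPolynomial.map (algebraMap (𝓞 K) (AlgebraicClosure K)) G) := by
      rw [hu]
      exact (irreducible_mul_isUnit hunit).2 hF
    obtain ⟨S, hS0, hSaux, hScov, hScard⟩ := hS G (by omega) hGirr B
      ((le_max_right _ _).trans hB) hGH
    refine ⟨S, hS0, fun P hP => ⟨(hSaux P hP).1, ?_⟩, fun x hx hxB =>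
      hScov x (hGF x hx hxB) hxB, hScard⟩
    have h := (hSaux P hP).2
    rw [hu] at h
    exact h.of_mul_left_left
  · refine ⟨{G}, Finset.singleton_nonempty _, fun P hP => ?_, fun x hx hxB =>
      ⟨G, Finset.mem_singleton_self _, hGF x hx hxB⟩, ?_⟩
    · rw [Finset.mem_singleton.1 hP]
      exact ⟨hGd.trans hD, hF.isRelPrime_iff_not_dvd.2 hdvd⟩
    · rw [Finset.card_singleton, Nat.cast_one]
      exact Real.one_le_rpow hB1 (by positivity)

/-- **Generalized Heath-Brown theorem**: there is `c₂ > 0` depending only on `K` such that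
for all integers `D ≥ d ≥ 2` there is a threshold `B₀` (depending on `ρ, d, D`) such that for
every `F ∈ O_K[X₁,X₂]` absolutely irreducible of total degree `d` and every `B ≥ B₀`, there
are `k ≥ 1` polynomials `F₁,…,F_k ∈ O_K[X₁,X₂]` of degree `≤ D`, each relatively prime to `F`
over `K̄`, covering all zeros of `F` in `O_K²` of house `≤ B`, with
`k ≤ c₂ · d³ · (log(d³ H⁺(F) B^{d-1}))² · B^{ρ(1/d + 6/D)}`. -/
theorem heathBrownEffective (K : Type*) [Field K] [NumberField K] :
    ∃ c₂ > (0 : ℝ),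
      ∀ d D : ℕ, 2 ≤ d → d ≤ D →
        ∃ B₀ > (0 : ℝ), ∀ F : MvPolynomial (Fin 2) (𝓞 K),
          F.totalDegree = d →
          Irreducible (MvPolynomial.map (algebraMap (𝓞 K) (AlgebraicClosure K)) F) →
          ∀ B : ℝ, B₀ ≤ B →
            ∃ k : ℕ, 1 ≤ k ∧
              ∃ G : Fin k → MvPolynomial (Fin 2) (𝓞 K),
                (∀ i, (G i).totalDegree ≤ D ∧
                  IsRelPrime (MvPolynomial.map (algebraMap (𝓞 K) (AlgebraicClosure K)) F)
                    (MvPolynomial.map (algebraMap (𝓞 K) (AlgebraicClosure K)) (G i))) ∧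
                (∀ x₁ x₂ : 𝓞 K,
                  MvPolynomial.eval ![x₁, x₂] F = 0 →
                  house (x₁ : K) ≤ B → house (x₂ : K) ≤ B →
                  ∃ i, MvPolynomial.eval ![x₁, x₂] (G i) = 0) ∧
                (k : ℝ) ≤ c₂ * (d : ℝ) ^ 3 *
                  (Real.log ((d : ℝ) ^ 3 * mvHousePlus F * B ^ ((d : ℝ) - 1))) ^ 2 *
                  B ^ ((Module.finrank ℚ K : ℝ) * (1 / (d : ℝ) + 6 / (D : ℝ))) := by
  refine ⟨1, one_pos, fun d D hd hD => ?_⟩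
  obtain ⟨B₀, hB₀, h⟩ := exists_cover K hd hD
  refine ⟨B₀, by linarith, fun F hFd hF B hB => ?_⟩
  obtain ⟨S, hS0, hSaux, hScov, hScard⟩ := h F hFd hF B hB
  refine ⟨S.card, hS0.card_pos, fun i => S.equivFin.symm i, fun i => hSaux _ (Subtype.prop _),
    fun x₁ x₂ hx h₁ h₂ => ?_, hScard.trans ?_⟩
  · obtain ⟨G, hG, hGx⟩ := hScov ![x₁, x₂] hx (Fin.forall_fin_two.2 ⟨h₁, h₂⟩)
    exact ⟨S.equivFin ⟨G, hG⟩, by simpa using hGx⟩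
  · have hB1 : 1 ≤ B := hB₀.trans hB
    have hd2 : (2 : ℝ) ≤ d := by exact_mod_cast hd
    have hd8 : (8 : ℝ) ≤ (d : ℝ) ^ 3 := by
      calc (8 : ℝ) = 2 ^ 3 := by norm_num
        _ ≤ _ := by gcongr
    have harg : (8 : ℝ) ≤ (d : ℝ) ^ 3 * mvHousePlus F * B ^ ((d : ℝ) - 1) :=
      (hd8.trans (le_mul_of_one_le_right (by positivity) (le_max_left _ _))).trans
        (le_mul_of_one_le_right (mul_nonneg (by positivity)
          (zero_le_one.trans (le_max_left _ _))) (Real.one_le_rpow hB1 (by linarith)))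
    have hlog : 1 ≤ Real.log ((d : ℝ) ^ 3 * mvHousePlus F * B ^ ((d : ℝ) - 1)) := by
      rw [Real.le_log_iff_exp_le (by linarith)]
      linarith [Real.exp_one_lt_d9]
    refine le_mul_of_one_le_left (Real.rpow_nonneg (by linarith) _) ?_
    rw [one_mul]
    exact one_le_mul_of_one_le_of_one_le (by linarith) (one_le_pow₀ hlog)
end

section
/- Let F(X₁,X₂) ∈ O_K[X₁,X₂] have total degree d ≥ 2, let B > 1 be a real number, set h(B) = log₂(d³ · H⁺(F) · B^{d−1}) and r = ⌊ρ · h(B)⌋ + 1. There exist a constant C₁ depending only on K and a threshold P₀ (depending on K, F and B) such that for every integer P ≥ P₀ there exist r prime ideals 𝔭₁, …, 𝔭_r of O_K, each lying over a rational prime that is totally split in K/ℚ, whose absolute norms satisfy P ≤ N_{K/ℚ}(𝔭_i) ≤ C₁ · h(B)² · (P/log P) · log(P/log P), and such that for every (x₁,x₂) ∈ O_K² with F(x₁,x₂) = 0, H(x₁) ≤ B, H(x₂) ≤ B and (∂F/∂X₁)(x₁,x₂) ≠ 0, there is an index i with (∂F/∂X₁)(x₁,x₂) ∉ 𝔭_i.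 -/
open NumberField

/-- A rational prime `p` is totally split in `K/ℚ` if `pO_K` is a product of
`ρ = [K:ℚ]` distinct prime ideals of `O_K`. -/
def TotallySplit (K : Type*) [Field K] [NumberField K] (p : ℕ) : Prop :=
  ∃ s : Finset (Ideal (𝓞 K)), s.card = Module.finrank ℚ K ∧
    (∀ q ∈ s, q.IsPrime) ∧ Ideal.span {(p : 𝓞 K)} = ∏ q ∈ s, q

/-- In a Galois number field `L` containing `K`, the existence of a prime of degree one above `p`
forces every prime of `K` above `p` to have degree one. -/
lemma absNorm_eq_of_isGalois_of_absNorm_eq {K L : Type*} [Field K] [NumberField K] [Field L]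
    [NumberField L] [Algebra K L] [IsGalois ℚ L] {p : ℕ} (hp : p.Prime)
    (Q : Ideal (𝓞 L)) [Q.IsPrime] (hQ : Ideal.absNorm Q = p)
    (P : Ideal (𝓞 K)) [hP : P.LiesOver (Ideal.span {(p : ℤ)})] [P.IsPrime] :
    Ideal.absNorm P = p := by
  have hpi : Prime (p : ℤ) := Nat.prime_iff_prime_int.mp hp
  obtain ⟨Q', hQ'p, hQ'⟩ := Ideal.nonempty_primesOver (S := 𝓞 L) P
  have : Q'.LiesOver (Ideal.span {(p : ℤ)}) := Ideal.LiesOver.trans Q' P _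
  have : Q.LiesOver (Ideal.span {(p : ℤ)}) := by
    rw [Ideal.liesOver_span_iff (Ideal.IsPrime.ne_top ‹_›) hpi]
    simpa [hQ] using Ideal.absNorm_mem Q
  have h1 := Ideal.inertiaDeg_eq_of_isGaloisGroup (Ideal.span {(p : ℤ)}) Q Q' Gal(L/ℚ)
  have h2 := Ideal.absNorm_pow_inertiaDeg (Ideal.span {(p : ℤ)}) Q
  have h3 := Ideal.absNorm_pow_inertiaDeg (Ideal.span {(p : ℤ)}) Q'
  have h4 := Ideal.absNorm_pow_inertiaDeg P Q'
  rw [← h1, h2, hQ] at h3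
  rw [← h3] at h4
  exact (hp.pow_eq_iff.mp h4).1

lemma totallySplit_of_absNorm_eq {K : Type*} [Field K] [NumberField K] {p : ℕ} (hp : p.Prime)
    (hd : ¬ (p : ℤ) ∣ discr K)
    (h : ∀ P : Ideal (𝓞 K), P.IsPrime → P.LiesOver (Ideal.span {(p : ℤ)}) →
      Ideal.absNorm P = p) :
    TotallySplit K p := by
  classical
  have hpi : Prime (p : ℤ) := Nat.prime_iff_prime_int.mp hp
  set I : Ideal ℤ := Ideal.span {(p : ℤ)} with hI
  have hI0 : I ≠ ⊥ := by simpa [hI] using hp.ne_zero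
  have : I.IsPrime := by rwa [hI, Ideal.span_singleton_prime hpi.ne_zero]
  have : I.IsMaximal := this.isMaximal hI0
  have hmem (P : Ideal (𝓞 K)) (hP : P.IsPrime) (hl : P.LiesOver I) : (p : 𝓞 K) ∈ P := by
    have := (Ideal.liesOver_span_iff hP.ne_top hpi).mp hl
    simpa using this
  have hsum := Ideal.sum_ramification_inertia_eq_finrank I (𝓞 K)
  have hone : ∀ q : I.primesOver (𝓞 K), q.1.ramificationIdx ℤ * q.1.inertiaDeg ℤ = 1 := by
    intro q
    have : Algebra.IsUnramifiedAt ℤ q.1 :=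
      (NumberField.not_dvd_discr_iff_forall_mem K (𝓞 K) hpi).mp hd q.1 inferInstance
        (by simpa using hmem q.1 inferInstance inferInstance)
    have h1 := Ideal.ramificationIdx_eq_one q.1 ℤ
    have h2 := Ideal.absNorm_pow_inertiaDeg I q.1
    rw [h q.1 inferInstance inferInstance] at h2
    have : Ideal.absNorm I = p := by simp [hI]
    rw [this] at h2
    rw [h1, (hp.pow_eq_iff.mp h2).2]
  rw [Finset.sum_congr rfl (fun q _ ↦ hone q)] at hsum
  simp only [Finset.sum_const, Finset.card_univ, smul_eq_mul, mul_one] at hsum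
  rw [RingOfIntegers.rank] at hsum
  have hcard : (I.primesOver (𝓞 K)).toFinset.card = Module.finrank ℚ K := by
    rw [Set.toFinset_card, hsum]
  have hdvd : ∏ q ∈ (I.primesOver (𝓞 K)).toFinset, q ∣ Ideal.span {(p : 𝓞 K)} := by
    refine Finset.prod_primes_dvd _ (fun q hq ↦ ?_) (fun q hq ↦ ?_)
    · rw [Set.mem_toFinset] at hq
      obtain ⟨h1, h2⟩ := hq
      refine Ideal.prime_of_isPrime ?_ h1
      rintro rfl
      simpa [hp.ne_zero] using hmem _ h1 h2
    · rw [Set.mem_toFinset] at hq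
      rw [Ideal.dvd_span_singleton]
      exact hmem q hq.1 hq.2
  refine ⟨(I.primesOver (𝓞 K)).toFinset, hcard,
    fun q hq ↦ (Set.mem_toFinset.mp hq).1, ?_⟩
  obtain ⟨J, hJ⟩ := hdvd
  have hn := congrArg Ideal.absNorm hJ
  rw [map_mul, map_prod, Finset.prod_congr rfl (g := fun _ ↦ p) (fun q hq ↦
    h q (Set.mem_toFinset.mp hq).1 (Set.mem_toFinset.mp hq).2), Finset.prod_const, hcard,
    Ideal.absNorm_span_natCast, RingOfIntegers.rank] at hn
  have hJ1 : Ideal.absNorm J = 1 :=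
    Nat.eq_of_mul_eq_mul_left (pow_pos hp.pos (Module.finrank ℚ K)) (by simpa using hn.symm)
  rw [hJ, Ideal.absNorm_eq_one_iff.mp hJ1, Ideal.mul_top]

lemma exists_totallySplit_of_absNorm_eq {K L : Type*} [Field K] [NumberField K] [Field L]
    [NumberField L] [Algebra K L] [IsGalois ℚ L] {p : ℕ} (hp : p.Prime)
    (hd : ¬ (p : ℤ) ∣ discr K) (Q : Ideal (𝓞 L)) [Q.IsPrime] (hQ : Ideal.absNorm Q = p) :
    TotallySplit K p ∧ ∃ P : Ideal (𝓞 K), P.IsPrime ∧ Ideal.absNorm P = p := by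
  have hpi : Prime (p : ℤ) := Nat.prime_iff_prime_int.mp hp
  have : (Ideal.span {(p : ℤ)}).IsPrime := by rwa [Ideal.span_singleton_prime hpi.ne_zero]
  refine ⟨totallySplit_of_absNorm_eq hp hd
    fun P _ _ ↦ absNorm_eq_of_isGalois_of_absNorm_eq hp Q hQ P, ?_⟩
  obtain ⟨P, hP, hP'⟩ := Ideal.nonempty_primesOver (S := 𝓞 K) (Ideal.span {(p : ℤ)})
  exact ⟨P, hP, absNorm_eq_of_isGalois_of_absNorm_eq hp Q hQ P⟩

/-- Every number field is contained in a number field which is Galois over `ℚ`. -/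
lemma exists_numberField_isGalois (K : Type*) [Field K] [NumberField K] :
    ∃ L : IntermediateField ℚ ℂ, ∃ _ : NumberField L, IsGalois ℚ L ∧ Nonempty (Algebra K L) := by
  have h : IsNormalClosure ℚ K (IntermediateField.normalClosure ℚ K ℂ) :=
    Algebra.IsAlgebraic.isNormalClosure_normalClosure fun _ ↦ IsAlgClosed.splits _
  have := h.normal
  refine ⟨IntermediateField.normalClosure ℚ K ℂ, ⟨⟩, ⟨⟩, ?_⟩
  let f : K →ₐ[ℚ] ℂ := IsAlgClosed.lift
  exact ⟨(f.codRestrict (IntermediateField.normalClosure ℚ K ℂ).toSubalgebra fun x ↦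
    f.fieldRange_le_normalClosure ⟨x, rfl⟩).toRingHom.toAlgebra⟩

section BoxCount

variable {R : Type*} [CommRing R] {ι : Type*} [Fintype ι]

/-- Products of elements with bounded coordinates have bounded coordinates. -/
lemma exists_forall_abs_repr_mul_le (b : Module.Basis ι ℤ R) :
    ∃ A : ℕ, ∀ (a c : R) (D E : ℤ), (∀ i, |b.repr a i| ≤ D) → (∀ i, |b.repr c i| ≤ E) →
      ∀ i, |b.repr (a * c) i| ≤ A * (D * E) := by
  classical
  refine ⟨∑ i, ∑ j, ∑ k, (b.repr (b j * b k) i).natAbs, fun a c D E ha hc i ↦ ?_⟩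
  have h : b.repr (a * c) i = ∑ j, ∑ k, b.repr a j * b.repr c k * b.repr (b j * b k) i := by
    conv_lhs => rw [← b.sum_repr a, ← b.sum_repr c, Finset.sum_mul_sum]
    simp only [smul_mul_smul_comm, map_sum, map_zsmul, Finsupp.finsetSum_apply,
      Finsupp.smul_apply, smul_eq_mul]
  have hle : ∑ j, ∑ k, |b.repr (b j * b k) i| ≤
      ∑ i, ∑ j, ∑ k, |b.repr (b j * b k) i| :=
    Finset.single_le_sum (f := fun i ↦ ∑ j, ∑ k, |b.repr (b j * b k) i|)
      (fun i _ ↦ by positivity) (Finset.mem_univ i)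
  have hD : 0 ≤ D := (abs_nonneg _).trans (ha i)
  have hE : 0 ≤ E := (abs_nonneg _).trans (hc i)
  push_cast
  calc |b.repr (a * c) i|
      ≤ ∑ j, ∑ k, |b.repr a j * b.repr c k * b.repr (b j * b k) i| := by
        rw [h]
        exact (Finset.abs_sum_le_sum_abs _ _).trans
          (Finset.sum_le_sum fun j _ ↦ Finset.abs_sum_le_sum_abs _ _)
    _ ≤ ∑ j, ∑ k, |b.repr (b j * b k) i| * (D * E) := by
        refine Finset.sum_le_sum fun j _ ↦ Finset.sum_le_sum fun k _ ↦ ?_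
        rw [abs_mul, abs_mul, mul_comm]
        gcongr
        exacts [ha j, hc k]
    _ = (∑ j, ∑ k, |b.repr (b j * b k) i|) * (D * E) := by simp [Finset.sum_mul]
    _ ≤ _ := by gcongr

variable [IsDedekindDomain R] [Module.Free ℤ R]

/-- Minkowski-type lemma: a nonzero ideal of small norm contains a nonzero element with small
coordinates. -/
lemma exists_mem_ideal_abs_repr_lt (b : Module.Basis ι ℤ R) {I : Ideal R}
    (hI : Ideal.absNorm I ≠ 0) {m : ℕ} (hm : Ideal.absNorm I < m ^ Fintype.card ι) :
    ∃ v ∈ I, v ≠ 0 ∧ ∀ i, |b.repr v i| ≤ m := by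
  classical
  have hc : Nat.card (R ⧸ I) ≠ 0 := by
    rwa [Ideal.absNorm_apply, Submodule.cardQuot_apply] at hI
  have : Finite (R ⧸ I) := Nat.finite_of_card_ne_zero hc
  have : Fintype (R ⧸ I) := Fintype.ofFinite _
  obtain ⟨x, y, hxy, h⟩ := Fintype.exists_ne_map_eq_of_card_lt
    (fun x : ι → Fin m ↦ Ideal.Quotient.mk I (∑ i, ((x i : ℕ) : ℤ) • b i)) (by
      rw [← Nat.card_eq_fintype_card, Fintype.card_fun, Fintype.card_fin]
      rwa [Ideal.absNorm_apply, Submodule.cardQuot_apply] at hm)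
  rw [Ideal.Quotient.eq, ← Finset.sum_sub_distrib] at h
  simp_rw [← sub_smul] at h
  refine ⟨_, h, fun h0 ↦ hxy ?_, fun i ↦ ?_⟩
  · funext i
    have := congr(b.repr $h0 i)
    rw [b.repr_sum_self, map_zero, Finsupp.zero_apply, sub_eq_zero] at this
    exact Fin.ext (by exact_mod_cast this)
  · rw [b.repr_sum_self, abs_le]
    have := (x i).2
    have := (y i).2
    constructor <;> omega

/-- Every class modulo a nonzero ideal has a representative with small coordinates. -/
lemma exists_sub_mem_ideal_abs_repr_le (b : Module.Basis ι ℤ R) :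
    ∃ C : ℕ, ∀ (I : Ideal R) (m : ℕ), Ideal.absNorm I ≠ 0 → Ideal.absNorm I < m ^ Fintype.card ι →
      ∀ a, ∃ r, a - r ∈ I ∧ ∀ i, |b.repr r i| ≤ C * m := by
  obtain ⟨A, hA⟩ := exists_forall_abs_repr_mul_le b
  refine ⟨A, fun I m hI hm a ↦ ?_⟩
  obtain ⟨v, hvI, hv0, hv⟩ := exists_mem_ideal_abs_repr_lt b hI hm
  have : Module.Finite ℤ R := Module.Finite.of_basis b
  obtain ⟨w, hw⟩ := Ideal.mem_span_singleton'.1 (Ideal.absNorm_mem (Ideal.span {v}))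
  set M : ℕ := Ideal.absNorm (Ideal.span {v}) with hM
  have hM0 : 0 < M := Nat.pos_of_ne_zero fun h ↦ by
    rw [hM, Ideal.absNorm_eq_zero_iff, Ideal.span_singleton_eq_bot] at h
    exact hv0 h
  have hMz : (0 : ℤ) < M := by exact_mod_cast hM0
  set Q : R := ∑ i, (b.repr (a * w) i / (M : ℤ)) • b i with hQ
  set S : R := ∑ i, (b.repr (a * w) i % (M : ℤ)) • b i with hS
  have hsum : a * w = M * Q + S := by
    conv_lhs => rw [← b.sum_repr (a * w)]
    rw [hQ, hS, Finset.mul_sum, ← Finset.sum_add_distrib]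
    refine Finset.sum_congr rfl fun i _ ↦ ?_
    conv_lhs => rw [← Int.mul_ediv_add_emod (b.repr (a * w) i) M]
    simp only [zsmul_eq_mul]
    push_cast
    ring
  refine ⟨a - v * Q, by simpa using I.mul_mem_right Q hvI, fun i ↦ ?_⟩
  have hr : (M : ℤ) • (a - v * Q) = v * S := by
    have : S = a * w - M * Q := by rw [hsum]; ring
    rw [this, zsmul_eq_mul]
    push_cast
    rw [← hw]
    ring
  have hSb : ∀ i, |b.repr S i| ≤ M := fun i ↦ by
    rw [hS, b.repr_sum_self, abs_of_nonneg (Int.emod_nonneg _ hMz.ne')]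
    exact (Int.emod_lt_of_pos _ hMz).le
  have := hA v S m M hv hSb i
  rw [← hr, map_zsmul, Finsupp.smul_apply, smul_eq_mul, abs_mul, Nat.abs_cast] at this
  refine le_of_mul_le_mul_left (this.trans_eq ?_) hMz
  ring

/-- The elements whose coordinates lie in a given cube of side `X`. -/
noncomputable def coordBox {R : Type*} [CommRing R] {ι : Type*} [Fintype ι]
    (b : Module.Basis ι ℤ R) (u : ι → ℤ) (X : ℕ) : Finset R :=
  letI := Classical.decEq ι
  (Fintype.piFinset fun i ↦ Finset.Ico (u i) (u i + X)).map
    b.equivFun.symm.toEquiv.toEmbedding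

/-- The number of elements of an ideal in a box. -/
noncomputable def coordBoxCount {R : Type*} [CommRing R] {ι : Type*} [Fintype ι]
    (b : Module.Basis ι ℤ R) (u : ι → ℤ) (X : ℕ) (I : Ideal R) : ℕ :=
  letI := Classical.decPred (· ∈ I)
  ((coordBox b u X).filter (· ∈ I)).card

lemma mem_coordBox {R : Type*} [CommRing R] {ι : Type*} [Fintype ι] {b : Module.Basis ι ℤ R}
    {u : ι → ℤ} {X : ℕ} {a : R} :
    a ∈ coordBox b u X ↔ ∀ i, u i ≤ b.repr a i ∧ b.repr a i < u i + X := by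
  classical
  constructor
  · intro h
    obtain ⟨x, hx, rfl⟩ := Finset.mem_map.1 h
    intro i
    have := Finset.mem_Ico.1 (Fintype.mem_piFinset.1 hx i)
    have h2 : b.repr (b.equivFun.symm x) i = x i := congrFun (b.equivFun.apply_symm_apply x) i
    exact h2 ▸ this
  · exact fun h ↦ Finset.mem_map.2 ⟨b.equivFun a,
      Fintype.mem_piFinset.2 fun i ↦ Finset.mem_Ico.2 (h i), b.equivFun.symm_apply_apply a⟩

lemma card_coordBox {R : Type*} [CommRing R] {ι : Type*} [Fintype ι] (b : Module.Basis ι ℤ R)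
    (u : ι → ℤ) (X : ℕ) : (coordBox b u X).card = X ^ Fintype.card ι := by
  simp [coordBox]

lemma exists_coordBoxCount_bounds (b : Module.Basis ι ℤ R) :
    ∃ C : ℕ, ∀ (I : Ideal R) (m : ℕ), Ideal.absNorm I ≠ 0 → Ideal.absNorm I < m ^ Fintype.card ι →
      ∀ (u : ι → ℤ) (X : ℕ),
        X ^ Fintype.card ι ≤ Ideal.absNorm I *
          coordBoxCount b (fun i ↦ u i - C * m) (X + 2 * (C * m)) I ∧
        Ideal.absNorm I * coordBoxCount b u X I ≤ (X + 2 * (C * m)) ^ Fintype.card ι := by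
  classical
  obtain ⟨C, hC⟩ := exists_sub_mem_ideal_abs_repr_le b
  refine ⟨C, fun I m hI hm u X ↦ ?_⟩
  choose r hrI hr using hC I m hI hm
  have hN : Ideal.absNorm I = Nat.card (R ⧸ I) := by
    rw [Ideal.absNorm_apply, Submodule.cardQuot_apply]
  have : Finite (R ⧸ I) := Nat.finite_of_card_ne_zero (hN ▸ hI)
  have : Fintype (R ⧸ I) := Fintype.ofFinite _
  rw [hN, Nat.card_eq_fintype_card]
  constructor
  · rw [← card_coordBox b u X, mul_comm]
    refine (Finset.card_le_mul_card_image (f := Ideal.Quotient.mk I) _ _ ?_).trans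
      (Nat.mul_le_mul_left _ (Finset.card_le_univ _))
    intro c hc
    obtain ⟨a, ha, rfl⟩ := Finset.mem_image.1 hc
    refine Finset.card_le_card_of_injOn (· - r a) (fun x hx ↦ ?_) (sub_left_injective.injOn)
    obtain ⟨hx, hxa⟩ := Finset.mem_filter.1 (Finset.mem_coe.1 hx)
    refine Finset.mem_coe.2 (Finset.mem_filter.2 ⟨mem_coordBox.2 fun i ↦ ?_, ?_⟩)
    · have h1 := mem_coordBox.1 hx i
      have h2 := abs_le.1 (hr a i)
      rw [map_sub, Finsupp.sub_apply]
      push_cast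
      constructor <;> linarith [h1.1, h1.2, h2.1, h2.2]
    · rw [Ideal.Quotient.eq] at hxa
      have := I.add_mem hxa (hrI a)
      rwa [sub_add_sub_cancel] at this
  · rw [← card_coordBox b (fun i ↦ u i - C * m) (X + 2 * (C * m)), coordBoxCount,
      ← Finset.card_univ, ← Finset.card_product]
    have hmk : ∀ c : R ⧸ I, Ideal.Quotient.mk I (r c.out) = c := fun c ↦ by
      conv_rhs => rw [← Ideal.Quotient.mk_out c]
      exact (Ideal.Quotient.eq.2 (hrI _)).symm
    refine Finset.card_le_card_of_injOn (fun c ↦ r c.1.out + c.2) (fun x hx ↦ ?_) ?_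
    · obtain ⟨hx, -⟩ := Finset.mem_filter.1 (Finset.mem_product.1 (Finset.mem_coe.1 hx)).2
      refine Finset.mem_coe.2 (mem_coordBox.2 fun i ↦ ?_)
      have h1 := mem_coordBox.1 hx i
      have h2 := abs_le.1 (hr x.1.out i)
      rw [map_add, Finsupp.add_apply]
      push_cast
      constructor <;> linarith [h1.1, h1.2, h2.1, h2.2]
    · rintro ⟨c, x⟩ hx ⟨d, y⟩ hy h
      have hx := (Finset.mem_filter.1 (Finset.mem_product.1 (Finset.mem_coe.1 hx)).2).2
      have hy := (Finset.mem_filter.1 (Finset.mem_product.1 (Finset.mem_coe.1 hy)).2).2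
      have hcd : c = d := by
        have := congr(Ideal.Quotient.mk I $h)
        simpa [hmk, Ideal.Quotient.eq_zero_iff_mem.2 hx,
          Ideal.Quotient.eq_zero_iff_mem.2 hy] using this
      subst hcd
      simpa using h

lemma exists_coordBoxCount_real_bounds [Nonempty ι] (b : Module.Basis ι ℤ R) :
    ∃ C : ℝ, 0 ≤ C ∧ ∀ (I : Ideal R), Ideal.absNorm I ≠ 0 → ∀ (u : ι → ℤ) (X : ℕ), 0 < X →
      (X : ℝ) ^ Fintype.card ι *
          (1 - C * ((Ideal.absNorm I : ℝ) ^ (1 / Fintype.card ι : ℝ) / X)) ≤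
        Ideal.absNorm I * coordBoxCount b u X I ∧
      (Ideal.absNorm I : ℝ) * coordBoxCount b u X I ≤ (X : ℝ) ^ Fintype.card ι *
          (1 + C * ((Ideal.absNorm I : ℝ) ^ (1 / Fintype.card ι : ℝ) / X)) ^ Fintype.card ι := by
  obtain ⟨C, hC⟩ := exists_coordBoxCount_bounds b
  set n := Fintype.card ι with hn
  have hn0 : n ≠ 0 := Fintype.card_ne_zero
  have hn1 : (1 : ℝ) ≤ n := by exact_mod_cast Nat.one_le_iff_ne_zero.2 hn0
  refine ⟨n * (4 * C), by positivity, fun I hI u X hX ↦ ?_⟩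
  set t : ℝ := (Ideal.absNorm I : ℝ) ^ (1 / n : ℝ) with ht
  have hN1 : (1 : ℝ) ≤ Ideal.absNorm I := by exact_mod_cast Nat.one_le_iff_ne_zero.2 hI
  have ht1 : 1 ≤ t := Real.one_le_rpow hN1 (by positivity)
  have htn : t ^ n = Ideal.absNorm I := by
    rw [ht, one_div, Real.rpow_inv_natCast_pow (by positivity) hn0]
  set m : ℕ := ⌊t⌋₊ + 1 with hm
  have htm : t < m := by rw [hm]; push_cast; exact Nat.lt_floor_add_one t
  have hmt : (m : ℝ) ≤ 2 * t := by
    rw [hm]; push_cast; linarith [Nat.floor_le (zero_le_one.trans ht1)]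
  have hNm : Ideal.absNorm I < m ^ n := by
    have : (Ideal.absNorm I : ℝ) < (m : ℝ) ^ n := by
      rw [← htn]; exact pow_lt_pow_left₀ htm (zero_le_one.trans ht1) hn0
    exact_mod_cast this
  have hX0 : (0 : ℝ) < X := by exact_mod_cast hX
  constructor
  · by_cases hXm : 2 * (C * m) ≤ X
    · have h := (hC I m hI hNm (fun i ↦ u i + C * m) (X - 2 * (C * m))).1
      rw [Nat.sub_add_cancel hXm] at h
      simp only [add_sub_cancel_right] at h
      have h' : ((X : ℝ) - 2 * (C * m)) ^ n ≤ Ideal.absNorm I * coordBoxCount b u X I := by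
        exact_mod_cast (Nat.cast_le (α := ℝ).2 h)
      refine le_trans ?_ h'
      have hXm' : 2 * (C * (m : ℝ)) ≤ X := by exact_mod_cast hXm
      have e : (X : ℝ) - 2 * (C * m) = X * (1 + -(2 * (C * m) / X)) := by field_simp; ring
      rw [e, mul_pow]
      gcongr
      have hle : 2 * (C * (m : ℝ)) / X ≤ 1 := (div_le_one hX0).2 hXm'
      refine le_trans ?_ (one_add_mul_le_pow (by linarith) n)
      have : 2 * (C * (m : ℝ)) / X ≤ 4 * C * (t / X) := by
        rw [← mul_div_assoc]
        gcongr ?_ / _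
        nlinarith [(Nat.cast_nonneg C : (0 : ℝ) ≤ C)]
      nlinarith
    · refine le_trans ?_ (by positivity : (0 : ℝ) ≤ _)
      refine mul_nonpos_of_nonneg_of_nonpos (by positivity) ?_
      have hXm' : (X : ℝ) < 2 * (C * (m : ℝ)) := by exact_mod_cast not_le.1 hXm
      have h1 : 1 ≤ 4 * C * (t / X) := by
        rw [← mul_div_assoc, one_le_div hX0]
        nlinarith [(Nat.cast_nonneg C : (0 : ℝ) ≤ C)]
      nlinarith
  · have h := (hC I m hI hNm u X).2
    have h' : (Ideal.absNorm I : ℝ) * coordBoxCount b u X I ≤ ((X : ℝ) + 2 * (C * m)) ^ n := by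
      exact_mod_cast (Nat.cast_le (α := ℝ).2 h)
    refine h'.trans ?_
    rw [← mul_pow]
    refine pow_le_pow_left₀ (by positivity) ?_ n
    rw [mul_add, mul_one]
    have e : (X : ℝ) * (n * (4 * C) * (t / X)) = n * (4 * (C * t)) := by field_simp
    rw [e]
    have h0 : 0 ≤ (C : ℝ) * t := by positivity
    nlinarith [(Nat.cast_nonneg C : (0 : ℝ) ≤ C)]

end BoxCount

lemma absNorm_span_singleton_eq_prod {L : Type*} [Field L] [NumberField L] (a : 𝓞 L) :
    (Ideal.absNorm (Ideal.span {a}) : ℝ) = ∏ σ : L →+* ℂ, ‖σ (a : L)‖ := by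
  have h := Algebra.norm_eq_prod_embeddings ℚ ℂ (a : L)
  have h2 : ∏ σ : L →ₐ[ℚ] ℂ, σ (a : L) = ∏ σ : L →+* ℂ, σ (a : L) :=
    Fintype.prod_equiv (RingHom.equivRatAlgHom L ℂ).symm _ _ fun _ ↦ rfl
  rw [Ideal.absNorm_span_singleton, ← norm_prod, ← h2, ← h, ← Algebra.coe_norm_int]
  simp [Nat.cast_natAbs]

/-- A family of boxes whose elements all have conjugates of comparable size. -/
lemma exists_box_absNorm_bounds (L : Type*) [Field L] [NumberField L] :
    ∃ (u : Module.Free.ChooseBasisIndex ℤ (𝓞 L) → ℤ) (c : ℕ), 0 < c ∧ ∀ X : ℕ, 0 < X →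
      ∀ a ∈ coordBox (RingOfIntegers.basis L) (fun i ↦ X * u i) X,
        X ^ Module.finrank ℚ L ≤ Ideal.absNorm (Ideal.span {a}) ∧
        Ideal.absNorm (Ideal.span {a}) ≤ (c * X) ^ Module.finrank ℚ L := by
  set b := RingOfIntegers.basis L
  set B : ℝ := ∑ i, house (b i : L) with hB
  have hB0 : 0 ≤ B := Finset.sum_nonneg fun i _ ↦ house_nonneg _
  set A : ℕ := ⌈B⌉₊ + 1 with hA
  have hAB : B + 1 ≤ A := by rw [hA]; push_cast; linarith [Nat.le_ceil B]
  refine ⟨fun i ↦ b.repr (A : 𝓞 L) i, 2 * A, by omega, fun X hX a ha ↦ ?_⟩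
  have key : ∀ σ : L →+* ℂ, ‖σ (a : L) - X * A‖ ≤ X * B := fun σ ↦ by
    have hd : a - X * A = ∑ i, (b.repr a i - X * b.repr (A : 𝓞 L) i) • b i := by
      simp_rw [sub_smul, Finset.sum_sub_distrib, mul_smul, ← Finset.smul_sum]
      rw [b.sum_repr, b.sum_repr]
      simp
    have hd2 : σ (a : L) - X * A =
        ∑ i, ((b.repr a i - X * b.repr (A : 𝓞 L) i : ℤ) : ℂ) * σ (b i : L) := by
      have := congr(σ ($hd : L))
      simpa [zsmul_eq_mul] using this
    rw [hd2, hB, Finset.mul_sum]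
    refine (norm_sum_le _ _).trans (Finset.sum_le_sum fun i _ ↦ ?_)
    rw [norm_mul]
    have h1 := mem_coordBox.1 ha i
    have h2 : |b.repr a i - X * b.repr (A : 𝓞 L) i| ≤ X := by
      rw [abs_le]; constructor <;> linarith [h1.1, h1.2]
    refine mul_le_mul ?_ (norm_embedding_le_house _ _) (norm_nonneg _) (by positivity)
    rw [Complex.norm_intCast]
    exact_mod_cast h2
  have hX0 : (0 : ℝ) < X := by exact_mod_cast hX
  have hXA : ‖(X * A : ℂ)‖ = X * A := by simp
  rw [← Embeddings.card L ℂ, ← Nat.cast_le (α := ℝ), ← Nat.cast_le (α := ℝ),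
    absNorm_span_singleton_eq_prod, ← Finset.card_univ]
  push_cast
  rw [← Finset.prod_const, ← Finset.prod_const]
  constructor
  · refine Finset.prod_le_prod (fun _ _ ↦ by positivity) fun σ _ ↦ ?_
    have := norm_sub_norm_le (X * A : ℂ) (σ (a : L))
    rw [norm_sub_rev, hXA] at this
    nlinarith [key σ]
  · refine Finset.prod_le_prod (fun _ _ ↦ by positivity) fun σ _ ↦ ?_
    have := norm_sub_norm_le (σ (a : L)) (X * A : ℂ)
    rw [hXA] at this
    nlinarith [key σ]

section LogNorm

lemma one_lt_absNorm_of_isPrime {R : Type*} [CommRing R] [IsDedekindDomain R]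
    [Module.Free ℤ R] [Module.Finite ℤ R] {q : Ideal R} (h0 : q ≠ ⊥) (hq : q.IsPrime) :
    1 < Ideal.absNorm q := by
  have h1 := mt Ideal.absNorm_eq_zero_iff.1 h0
  have h2 := mt Ideal.absNorm_eq_one_iff.1 hq.ne_top
  omega

variable (R : Type*) [CommRing R] [IsDedekindDomain R] [Module.Free ℤ R] [Module.Finite ℤ R]
  [CharZero R]

/-- The finite set of nonzero prime ideals of norm at most `Z`. -/
noncomputable def primeIdealsLE (R : Type*) [CommRing R] [IsDedekindDomain R] [Module.Free ℤ R]
    [Module.Finite ℤ R] [CharZero R] (Z : ℕ) : Finset (Ideal R) :=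
  letI := Classical.decPred fun q : Ideal R ↦ q ≠ ⊥ ∧ q.IsPrime
  (Ideal.finite_setOfPred_absNorm_le (S := R) Z).toFinset.filter fun q ↦ q ≠ ⊥ ∧ q.IsPrime

variable {R}

lemma mem_primeIdealsLE {Z : ℕ} {q : Ideal R} :
    q ∈ primeIdealsLE R Z ↔ Ideal.absNorm q ≤ Z ∧ q ≠ ⊥ ∧ q.IsPrime := by
  simp [primeIdealsLE]

open UniqueFactorizationMonoid in
open Classical in
lemma log_absNorm_eq_sum {J : Ideal R} (hJ : J ≠ ⊥) {Z : ℕ} (hZ : Ideal.absNorm J ≤ Z) :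
    Real.log (Ideal.absNorm J) = ∑ q ∈ primeIdealsLE R Z, ∑ k ∈ Finset.Icc 1 Z,
      if J ≤ q ^ k then Real.log (Ideal.absNorm q) else 0 := by
  have hN0 : Ideal.absNorm J ≠ 0 := mt Ideal.absNorm_eq_zero_iff.1 hJ
  have hcount : ∀ q ∈ primeIdealsLE R Z, (∑ k ∈ Finset.Icc 1 Z,
      if J ≤ q ^ k then Real.log (Ideal.absNorm q) else 0) =
      (normalizedFactors J).count q * Real.log (Ideal.absNorm q) := fun q hq ↦ by
    obtain ⟨-, hq0, hqp⟩ := mem_primeIdealsLE.1 hq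
    have hirr := (Ideal.prime_of_isPrime hq0 hqp).irreducible
    have hiff : ∀ k : ℕ, J ≤ q ^ k ↔ k ≤ (normalizedFactors J).count q := fun k ↦ by
      rw [← Ideal.dvd_iff_le, pow_dvd_iff_le_emultiplicity,
        emultiplicity_eq_count_normalizedFactors hirr hJ, normalize_eq, Nat.cast_le]
    have hle : (normalizedFactors J).count q ≤ Z := by
      have h1 := Ideal.absNorm_dvd_absNorm_of_le ((hiff _).2 le_rfl)
      rw [map_pow] at h1
      refine le_trans ?_ ((Nat.le_of_dvd (Nat.pos_of_ne_zero hN0) h1).trans hZ)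
      exact (Nat.lt_pow_self (one_lt_absNorm_of_isPrime hq0 hqp)).le
    rw [← Finset.sum_filter, Finset.sum_const, nsmul_eq_mul]
    congr 2
    rw [← Nat.add_sub_cancel (n := (normalizedFactors J).count q) (m := 1), ← Nat.card_Icc]
    congr 1
    ext k
    simp only [Finset.mem_filter, Finset.mem_Icc, hiff]
    omega
  rw [Finset.sum_congr rfl hcount]
  conv_lhs => rw [← Ideal.prod_normalizedFactors_eq_self hJ, map_multiset_prod,
    Finset.prod_multiset_map_count]
  push_cast
  have hp : ∀ q ∈ normalizedFactors J, q ≠ ⊥ ∧ q.IsPrime := fun q hq ↦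
    ⟨(prime_of_normalized_factor q hq).ne_zero,
      Ideal.isPrime_of_prime (prime_of_normalized_factor q hq)⟩
  rw [Real.log_prod fun q hq ↦ pow_ne_zero _ (by
    have := one_lt_absNorm_of_isPrime (hp q (Multiset.mem_toFinset.1 hq)).1
      (hp q (Multiset.mem_toFinset.1 hq)).2
    positivity)]
  simp_rw [Real.log_pow]
  refine Finset.sum_subset (fun q hq ↦ ?_) fun q _ hq ↦ ?_
  · rw [Multiset.mem_toFinset] at hq
    refine mem_primeIdealsLE.2 ⟨(Nat.le_of_dvd (Nat.pos_of_ne_zero hN0) ?_).trans hZ, hp q hq⟩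
    exact Ideal.absNorm_dvd_absNorm_of_le
      (Ideal.dvd_iff_le.1 (dvd_of_mem_normalizedFactors hq))
  · rw [Multiset.mem_toFinset] at hq
    simp [Multiset.count_eq_zero_of_notMem hq]

/-- The sum of `log N(a)` over a finite set of nonzero elements, counted by prime powers. -/
lemma sum_log_absNorm_box {ι : Type*} [Fintype ι] (b : Module.Basis ι ℤ R) (u : ι → ℤ) (X Z : ℕ)
    (h : ∀ a ∈ coordBox b u X, Ideal.absNorm (Ideal.span {a}) ≠ 0 ∧
      Ideal.absNorm (Ideal.span {a}) ≤ Z) :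
    ∑ a ∈ coordBox b u X, Real.log (Ideal.absNorm (Ideal.span {a})) =
      ∑ q ∈ primeIdealsLE R Z, ∑ k ∈ Finset.Icc 1 Z,
        Real.log (Ideal.absNorm q) * coordBoxCount b u X (q ^ k) := by
  classical
  rw [Finset.sum_congr rfl fun a ha ↦
    log_absNorm_eq_sum (mt Ideal.absNorm_eq_zero_iff.2 (h a ha).1) (h a ha).2, Finset.sum_comm]
  refine Finset.sum_congr rfl fun q _ ↦ ?_
  rw [Finset.sum_comm]
  refine Finset.sum_congr rfl fun k _ ↦ ?_
  rw [← Finset.sum_filter, Finset.sum_const, nsmul_eq_mul, mul_comm, coordBoxCount]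
  simp only [Ideal.span_singleton_le_iff_mem]

end LogNorm

section PrimesAbove

variable {R : Type*} [CommRing R] [IsDedekindDomain R] [Module.Free ℤ R] [Module.Finite ℤ R]

lemma absNorm_eq_minFac_pow {q : Ideal R} (h0 : q ≠ ⊥) (hq : q.IsPrime) :
    (Ideal.absNorm q).minFac.Prime ∧ ((Ideal.absNorm q).minFac : R) ∈ q ∧
      ∃ k, 1 ≤ k ∧ Ideal.absNorm q = (Ideal.absNorm q).minFac ^ k := by
  have h1 := one_lt_absNorm_of_isPrime h0 hq
  have hmem : ∃ p : ℕ, p.Prime ∧ (p : R) ∈ q := by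
    by_contra! h
    have key : ∀ m : ℕ, m ≠ 0 → (m : R) ∉ q := fun m ↦ by
      induction m using Nat.recOnMul with
      | zero => simp
      | one => exact fun _ ↦ by simpa using (Ideal.ne_top_iff_one q).1 hq.ne_top
      | prime p hp => exact fun _ ↦ h p hp
      | mul a b ha hb =>
        intro hab hmem
        rw [Nat.cast_mul] at hmem
        rcases hq.mem_or_mem hmem with h | h
        · exact ha (left_ne_zero_of_mul hab) h
        · exact hb (right_ne_zero_of_mul hab) h
    exact key _ (by omega) (Ideal.absNorm_mem q)
  obtain ⟨p, hp, hpq⟩ := hmem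
  have hdvd : Ideal.absNorm q ∣ p ^ Module.finrank ℤ R := by
    rw [← Ideal.absNorm_span_natCast]
    exact Ideal.absNorm_dvd_absNorm_of_le ((Ideal.span_singleton_le_iff_mem _).2 hpq)
  obtain ⟨k, -, hk⟩ := (Nat.dvd_prime_pow hp).1 hdvd
  have hk0 : k ≠ 0 := by rintro rfl; rw [pow_zero] at hk; omega
  have hmf : (Ideal.absNorm q).minFac = p := by rw [hk, Nat.Prime.pow_minFac hp hk0]
  rw [hmf]
  exact ⟨hp, hpq, k, Nat.one_le_iff_ne_zero.2 hk0, hk⟩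

lemma card_primes_le_finrank {p : ℕ} (hp : p.Prime) (hp0 : (p : R) ≠ 0) (s : Finset (Ideal R))
    (hs : ∀ q ∈ s, q.IsPrime ∧ (p : R) ∈ q) : s.card ≤ Module.finrank ℤ R := by
  have hs0 : ∀ q ∈ s, q ≠ ⊥ := fun q hq h ↦ hp0 (by simpa [h] using (hs q hq).2)
  have hdvd : ∏ q ∈ s, q ∣ Ideal.span {(p : R)} :=
    Finset.prod_primes_dvd _ (fun q hq ↦ Ideal.prime_of_isPrime (hs0 q hq) (hs q hq).1)
      fun q hq ↦ Ideal.dvd_span_singleton.2 (hs q hq).2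
  have h1 := Ideal.absNorm_dvd_absNorm_of_le (Ideal.dvd_iff_le.1 hdvd)
  rw [Ideal.absNorm_span_natCast, map_prod] at h1
  refine (Nat.pow_dvd_pow_iff_le_right hp.one_lt).1 (dvd_trans ?_ h1)
  rw [← Finset.prod_const]
  refine Finset.prod_dvd_prod_of_dvd _ _ fun q hq ↦ ?_
  obtain ⟨hp', hmem, k, hk, h⟩ := absNorm_eq_minFac_pow (hs0 q hq) (hs q hq).1
  have : (Ideal.absNorm q).minFac = p := by
    by_contra hne
    have hco : IsCoprime (((Ideal.absNorm q).minFac : ℤ)) (p : ℤ) :=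
      Nat.isCoprime_iff_coprime.2 ((Nat.coprime_primes hp' hp).2 hne)
    obtain ⟨x, y, hxy⟩ := hco
    refine (Ideal.ne_top_iff_one q).1 (hs q hq).1.ne_top ?_
    have := congr((($hxy : ℤ) : R))
    push_cast at this
    rw [← this]
    exact q.add_mem (q.mul_mem_left _ hmem) (q.mul_mem_left _ (hs q hq).2)
  rw [← this]
  exact Nat.minFac_dvd _

/-- Comparison of sums over prime ideals with sums over rational primes. -/
lemma sum_primeIdealsLE_le [CharZero R] (Z : ℕ) (f : ℕ → ℝ) (hf : ∀ p, 0 ≤ f p) :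
    ∑ q ∈ primeIdealsLE R Z, f (Ideal.absNorm q).minFac ≤
      Module.finrank ℤ R * ∑ p ∈ Finset.Icc 1 Z with p.Prime, f p := by
  classical
  have hmaps : ∀ q ∈ primeIdealsLE R Z, (Ideal.absNorm q).minFac ∈
      (Finset.Icc 1 Z).filter Nat.Prime := fun q hq ↦ by
    obtain ⟨hle, h0, hq⟩ := mem_primeIdealsLE.1 hq
    have h1 := one_lt_absNorm_of_isPrime h0 hq
    exact Finset.mem_filter.2 ⟨Finset.mem_Icc.2 ⟨Nat.minFac_pos _,
      (Nat.minFac_le (by omega)).trans hle⟩, (absNorm_eq_minFac_pow h0 hq).1⟩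
  rw [← Finset.sum_fiberwise_of_maps_to hmaps, Finset.mul_sum]
  refine Finset.sum_le_sum fun p hp ↦ ?_
  have hp' := (Finset.mem_filter.1 hp).2
  rw [Finset.sum_congr rfl fun q hq ↦ by rw [(Finset.mem_filter.1 hq).2], Finset.sum_const,
    nsmul_eq_mul]
  refine mul_le_mul_of_nonneg_right ?_ (hf p)
  refine Nat.cast_le.2 (card_primes_le_finrank hp' (Nat.cast_ne_zero.2 hp'.ne_zero) _ ?_)
  intro q hq
  obtain ⟨hq1, rfl⟩ := Finset.mem_filter.1 hq
  obtain ⟨-, h0, hq⟩ := mem_primeIdealsLE.1 hq1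
  exact ⟨hq, (absNorm_eq_minFac_pow h0 hq).2.1⟩

end PrimesAbove

section PrimeSums

lemma sum_log_primes_le (Y : ℕ) :
    ∑ p ∈ Finset.Icc 1 Y with p.Prime, Real.log p ≤ Real.log 4 * Y := by
  have := Chebyshev.theta_le_log4_mul_x (x := Y) (by positivity)
  rw [Chebyshev.theta_eq_sum_Icc] at this
  refine le_trans (le_of_eq ?_) this
  rw [Nat.floor_natCast]
  refine Finset.sum_congr ?_ fun _ _ ↦ rfl
  ext p
  simp only [Finset.mem_filter, Finset.mem_Icc]
  exact ⟨fun h ↦ ⟨⟨zero_le, h.1.2⟩, h.2⟩, fun h ↦ ⟨⟨h.2.one_lt.le, h.1.2⟩, h.2⟩⟩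

lemma exists_sum_log_mul_rpow_le {α : ℝ} (h0 : 0 < α) (h1 : α ≤ 1) :
    ∃ C : ℝ, 0 ≤ C ∧ ∀ Y : ℕ,
      ∑ p ∈ Finset.Icc 1 Y with p.Prime, Real.log p * (p : ℝ) ^ (α - 1) ≤ C * (Y : ℝ) ^ α := by
  have h2 : (2⁻¹ : ℝ) ^ α < 1 := Real.rpow_lt_one (by norm_num) (by norm_num) h0
  have hl4 : 0 < Real.log 4 := Real.log_pos (by norm_num)
  set C : ℝ := 2 * Real.log 4 / (1 - (2⁻¹ : ℝ) ^ α) with hC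
  have hCe : C * (2⁻¹ : ℝ) ^ α + 2 * Real.log 4 = C := by
    have : (1 - (2⁻¹ : ℝ) ^ α) ≠ 0 := by linarith
    have : C * (1 - (2⁻¹ : ℝ) ^ α) = 2 * Real.log 4 := by
      rw [hC, div_mul_cancel₀ _ this]
    linarith
  have hC0 : 0 ≤ C := div_nonneg (by positivity) (by linarith)
  refine ⟨C, hC0, fun Y ↦ ?_⟩
  induction Y using Nat.strong_induction_on with
  | _ Y ih =>
  rcases Nat.eq_zero_or_pos Y with rfl | hY
  · simp; positivity
  have hY0 : (0 : ℝ) < Y := by exact_mod_cast hY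
  have hsplit : ∑ p ∈ Finset.Icc 1 Y with p.Prime, Real.log p * (p : ℝ) ^ (α - 1) ≤
      (∑ p ∈ Finset.Icc 1 (Y / 2) with p.Prime, Real.log p * (p : ℝ) ^ (α - 1)) +
      ∑ p ∈ Finset.Icc 1 Y with p.Prime, Real.log p * ((2⁻¹ : ℝ) * Y) ^ (α - 1) := by
    rw [← Finset.sum_filter_add_sum_filter_not _ (fun p ↦ p ≤ Y / 2)]
    refine add_le_add (le_of_eq (Finset.sum_congr ?_ fun _ _ ↦ rfl)) ?_
    · ext p
      simp only [Finset.mem_filter, Finset.mem_Icc]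
      have : Y / 2 ≤ Y := Nat.div_le_self _ _
      constructor
      · rintro ⟨⟨⟨a, b⟩, c⟩, d⟩; exact ⟨⟨a, d⟩, c⟩
      · rintro ⟨⟨a, b⟩, c⟩; exact ⟨⟨⟨a, b.trans this⟩, c⟩, b⟩
    · refine (Finset.sum_le_sum fun p hp ↦ ?_).trans
        (Finset.sum_le_sum_of_subset_of_nonneg (Finset.filter_subset _ _) fun p _ _ ↦ ?_)
      · obtain ⟨-, hp⟩ := Finset.mem_filter.1 hp
        refine mul_le_mul_of_nonneg_left ?_ (Real.log_natCast_nonneg p)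
        refine Real.rpow_le_rpow_of_nonpos (by positivity) ?_ (by linarith)
        have : Y ≤ 2 * p := by omega
        have : (Y : ℝ) ≤ 2 * p := by exact_mod_cast this
        linarith
      · exact mul_nonneg (Real.log_natCast_nonneg p) (by positivity)
  have hY2 : ((Y / 2 : ℕ) : ℝ) ^ α ≤ (2⁻¹ : ℝ) ^ α * (Y : ℝ) ^ α := by
    rw [← Real.mul_rpow (by positivity) (by positivity)]
    refine Real.rpow_le_rpow (by positivity) ?_ h0.le
    have := Nat.cast_div_le (α := ℝ) (m := Y) (n := 2)
    push_cast at this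
    linarith
  have hhalf : ((2⁻¹ : ℝ) * Y) ^ (α - 1) ≤ 2 * ((Y : ℝ) ^ α / Y) := by
    rw [Real.mul_rpow (by positivity) (by positivity), Real.rpow_sub_one hY0.ne']
    refine mul_le_mul_of_nonneg_right ?_ (by positivity)
    rw [Real.rpow_sub_one (by norm_num), div_eq_mul_inv, inv_inv]
    linarith
  calc _ ≤ C * ((Y / 2 : ℕ) : ℝ) ^ α + Real.log 4 * Y * (2 * ((Y : ℝ) ^ α / Y)) := by
        refine hsplit.trans (add_le_add (ih _ (Nat.div_lt_self hY one_lt_two)) ?_)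
        rw [← Finset.sum_mul]
        exact mul_le_mul (sum_log_primes_le Y) hhalf (by positivity) (by positivity)
    _ ≤ C * ((2⁻¹ : ℝ) ^ α * (Y : ℝ) ^ α) + 2 * Real.log 4 * (Y : ℝ) ^ α := by
        refine add_le_add (by gcongr) (le_of_eq ?_)
        field_simp
    _ = C * (Y : ℝ) ^ α := by
        conv_rhs => rw [← hCe]
        ring

end PrimeSums

section IdealSums

variable (R : Type*) [CommRing R] [IsDedekindDomain R] [Module.Free ℤ R] [Module.Finite ℤ R]
  [CharZero R]

lemma exists_sum_log_absNorm_mul_rpow_le {α : ℝ} (h0 : 0 < α) (h1 : α ≤ 1) :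
    ∃ C : ℝ, 0 ≤ C ∧ ∀ Y : ℕ, ∑ q ∈ primeIdealsLE R Y with (Ideal.absNorm q).Prime,
      Real.log (Ideal.absNorm q) / Ideal.absNorm q * (Ideal.absNorm q : ℝ) ^ α ≤
        C * (Y : ℝ) ^ α := by
  obtain ⟨C, hC, h⟩ := exists_sum_log_mul_rpow_le h0 h1
  refine ⟨Module.finrank ℤ R * C, by positivity, fun Y ↦ ?_⟩
  have hf : ∀ p : ℕ, 0 ≤ Real.log p * (p : ℝ) ^ (α - 1) := fun p ↦
    mul_nonneg (Real.log_natCast_nonneg p) (by positivity)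
  calc _ = ∑ q ∈ primeIdealsLE R Y with (Ideal.absNorm q).Prime,
        Real.log (Ideal.absNorm q).minFac * ((Ideal.absNorm q).minFac : ℝ) ^ (α - 1) := by
        refine Finset.sum_congr rfl fun q hq ↦ ?_
        have hp := (Finset.mem_filter.1 hq).2
        rw [hp.minFac_eq, Real.rpow_sub_one (by exact_mod_cast hp.ne_zero)]
        ring
    _ ≤ ∑ q ∈ primeIdealsLE R Y,
        Real.log (Ideal.absNorm q).minFac * ((Ideal.absNorm q).minFac : ℝ) ^ (α - 1) :=
        Finset.sum_le_sum_of_subset_of_nonneg (Finset.filter_subset _ _) fun q _ _ ↦ hf _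
    _ ≤ Module.finrank ℤ R * (C * (Y : ℝ) ^ α) :=
        (sum_primeIdealsLE_le Y _ hf).trans (by gcongr; exact h Y)
    _ = _ := by ring

lemma log_div_pow_le {N p : ℕ} {f k : ℕ} (hp : 2 ≤ p) (hf : 1 ≤ f) (hk : 1 ≤ k)
    (hfk : f ≠ 1 ∨ k ≠ 1) (hN : N = p ^ f) :
    Real.log N / (N : ℝ) ^ k ≤ 16 * (p : ℝ) ^ (-(3 / 2) : ℝ) * (1 / 2) ^ k := by
  have hp0 : (0 : ℝ) < p := by positivity
  have hp1 : (1 : ℝ) ≤ p := by exact_mod_cast (by omega : 1 ≤ p)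
  have hNp : p ≤ N := by rw [hN]; exact Nat.le_self_pow (by omega) p
  have hNp' : (p : ℝ) ≤ N := by exact_mod_cast hNp
  have hN0 : (0 : ℝ) < N := by linarith
  have hN2 : (2 : ℝ) ≤ N := by exact_mod_cast hp.trans hNp
  have hlog : Real.log N ≤ 4 * (N : ℝ) ^ (1 / 4 : ℝ) := by
    have := Real.log_le_rpow_div hN0.le (show (0 : ℝ) < 1 / 4 by norm_num)
    linarith
  rcases eq_or_ne k 1 with rfl | hk1
  · have hf2 : 2 ≤ f := by omega
    have hNp2 : (p : ℝ) ^ 2 ≤ N := by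
      rw [hN]; push_cast; exact pow_le_pow_right₀ hp1 hf2
    have h1 : (N : ℝ) ^ (-(3 / 4) : ℝ) ≤ (p : ℝ) ^ (-(3 / 2) : ℝ) := by
      calc (N : ℝ) ^ (-(3 / 4) : ℝ) ≤ ((p : ℝ) ^ 2) ^ (-(3 / 4) : ℝ) :=
            Real.rpow_le_rpow_of_nonpos (by positivity) hNp2 (by norm_num)
        _ = _ := by
            rw [← Real.rpow_natCast, ← Real.rpow_mul hp0.le]; norm_num
    calc Real.log N / (N : ℝ) ^ 1 ≤ 4 * (N : ℝ) ^ (1 / 4 : ℝ) / (N : ℝ) ^ (1 : ℝ) := by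
          rw [Real.rpow_one, pow_one]; gcongr
      _ = 4 * (N : ℝ) ^ (-(3 / 4) : ℝ) := by
          rw [mul_div_assoc, ← Real.rpow_sub hN0]; norm_num
      _ ≤ _ := by
          have : (0 : ℝ) ≤ (p : ℝ) ^ (-(3 / 2) : ℝ) := by positivity
          linarith
  · obtain ⟨j, rfl⟩ := Nat.exists_eq_add_of_le (show 2 ≤ k by omega)
    have h1 : (N : ℝ) ^ (-(7 / 4) : ℝ) ≤ (p : ℝ) ^ (-(3 / 2) : ℝ) :=
      (Real.rpow_le_rpow_of_nonpos hp0 hNp' (by norm_num)).trans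
        (Real.rpow_le_rpow_of_exponent_le hp1 (by norm_num))
    have hj : (2 : ℝ) ^ j ≤ (N : ℝ) ^ j := by gcongr
    calc Real.log N / (N : ℝ) ^ (2 + j)
        ≤ 4 * (N : ℝ) ^ (1 / 4 : ℝ) / ((N : ℝ) ^ (2 : ℝ) * 2 ^ j) := by
          rw [pow_add, Real.rpow_two]; gcongr
      _ = 4 * (N : ℝ) ^ (-(7 / 4) : ℝ) * (1 / 2) ^ j := by
          have h : (N : ℝ) ^ (1 / 4 : ℝ) / (N : ℝ) ^ (2 : ℝ) = (N : ℝ) ^ (-(7 / 4) : ℝ) := by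
            rw [← Real.rpow_sub hN0]; norm_num
          rw [← h, one_div_pow]
          ring
      _ ≤ 4 * (p : ℝ) ^ (-(3 / 2) : ℝ) * (1 / 2) ^ j := by gcongr
      _ = _ := by rw [pow_add]; ring

/-- Prime powers other than primes of prime norm contribute a bounded amount. -/
lemma exists_sum_higher_prime_powers_le :
    ∃ C : ℝ, 0 ≤ C ∧ ∀ Z : ℕ, ∑ q ∈ primeIdealsLE R Z, ∑ k ∈ Finset.Icc 1 Z,
      (if k = 1 ∧ (Ideal.absNorm q).Prime then 0 else
        Real.log (Ideal.absNorm q) / (Ideal.absNorm q : ℝ) ^ k) ≤ C := by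
  have hs : Summable fun p : ℕ ↦ (p : ℝ) ^ (-(3 / 2) : ℝ) := by
    rw [Real.summable_nat_rpow]; norm_num
  refine ⟨Module.finrank ℤ R * (32 * ∑' p : ℕ, (p : ℝ) ^ (-(3 / 2) : ℝ)), ?_, fun Z ↦ ?_⟩
  · exact mul_nonneg (by positivity) (mul_nonneg (by norm_num) (tsum_nonneg fun _ ↦ by positivity))
  have hg : ∑ k ∈ Finset.Icc 1 Z, (1 / 2 : ℝ) ^ k ≤ 2 := by
    exact (summable_geometric_two.sum_le_tsum _ fun _ _ ↦ by positivity).trans_eq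
      tsum_geometric_two
  calc _ ≤ ∑ q ∈ primeIdealsLE R Z, 32 * ((Ideal.absNorm q).minFac : ℝ) ^ (-(3 / 2) : ℝ) := by
        refine Finset.sum_le_sum fun q hq ↦ ?_
        obtain ⟨-, hq0, hqp⟩ := mem_primeIdealsLE.1 hq
        obtain ⟨hp, -, f, hf, hN⟩ := absNorm_eq_minFac_pow hq0 hqp
        set p := (Ideal.absNorm q).minFac
        calc _ ≤ ∑ k ∈ Finset.Icc 1 Z, 16 * (p : ℝ) ^ (-(3 / 2) : ℝ) * (1 / 2) ^ k := by
              refine Finset.sum_le_sum fun k hk ↦ ?_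
              split_ifs with h
              · positivity
              · refine log_div_pow_le hp.two_le hf (Finset.mem_Icc.1 hk).1 ?_ hN
                by_contra! hc
                exact h ⟨hc.2, by rw [hN, hc.1, pow_one]; exact hp⟩
          _ ≤ 16 * (p : ℝ) ^ (-(3 / 2) : ℝ) * 2 := by
              rw [← Finset.mul_sum]; gcongr
          _ = _ := by ring
    _ ≤ Module.finrank ℤ R * ∑ p ∈ Finset.Icc 1 Z with p.Prime,
          32 * (p : ℝ) ^ (-(3 / 2) : ℝ) :=
        sum_primeIdealsLE_le Z (fun p ↦ 32 * (p : ℝ) ^ (-(3 / 2) : ℝ)) fun p ↦ by positivity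
    _ ≤ _ := by
        rw [← Finset.mul_sum]
        gcongr
        exact hs.sum_le_tsum _ fun _ _ ↦ by positivity

end IdealSums

section DegreeOne

variable (L : Type*) [Field L] [NumberField L]

/-- The Mertens sum over prime ideals of prime norm. -/
noncomputable def mertensDegreeOne (L : Type*) [Field L] [NumberField L] (Y : ℕ) : ℝ :=
  ∑ q ∈ primeIdealsLE (𝓞 L) Y with (Ideal.absNorm q).Prime,
    Real.log (Ideal.absNorm q) / Ideal.absNorm q

lemma card_basisIndex_eq_finrank :
    Fintype.card (Module.Free.ChooseBasisIndex ℤ (𝓞 L)) = Module.finrank ℚ L := by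
  rw [← RingOfIntegers.rank, Module.finrank_eq_card_basis (RingOfIntegers.basis L)]

lemma log_div_nonneg (N : ℕ) (k : ℕ) : 0 ≤ Real.log N / (N : ℝ) ^ k :=
  div_nonneg (Real.log_natCast_nonneg N) (by positivity)

lemma natCast_pow_rpow_one_div {X n : ℕ} (hn : n ≠ 0) : (((X ^ n : ℕ) : ℝ)) ^ (1 / n : ℝ) = X := by
  rw [Nat.cast_pow, one_div, Real.pow_rpow_inv_natCast (by positivity) hn]

lemma exists_mertensDegreeOne_le :
    ∃ C : ℝ, ∀ X : ℕ, 0 < X → mertensDegreeOne L (X ^ Module.finrank ℚ L) ≤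
      Module.finrank ℚ L * Real.log X + C := by
  obtain ⟨u, c, hc, hbox⟩ := exists_box_absNorm_bounds L
  obtain ⟨A, hA, hcnt⟩ := exists_coordBoxCount_real_bounds (RingOfIntegers.basis L)
  set n := Module.finrank ℚ L with hn
  have hn0 : n ≠ 0 := Module.finrank_pos.ne'
  have hn1 : (1 : ℝ) ≤ n := by exact_mod_cast Nat.one_le_iff_ne_zero.2 hn0
  simp only [card_basisIndex_eq_finrank, ← hn] at hcnt
  obtain ⟨D, hD, hsum⟩ := exists_sum_log_absNorm_mul_rpow_le (𝓞 L) (α := 1 / n) (by positivity)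
    ((div_le_one (by positivity)).2 hn1)
  refine ⟨n * Real.log c + A * D, fun X hX ↦ ?_⟩
  have hX0 : (0 : ℝ) < X := by exact_mod_cast hX
  set b := RingOfIntegers.basis L
  set U : Module.Free.ChooseBasisIndex ℤ (𝓞 L) → ℤ := fun i ↦ X * u i
  have hT := sum_log_absNorm_box b U X ((c * X) ^ n) fun a ha ↦
    ⟨((pow_pos hX n).trans_le (hbox X hX a ha).1).ne', (hbox X hX a ha).2⟩
  have hle : ∑ a ∈ coordBox b U X, Real.log (Ideal.absNorm (Ideal.span {a})) ≤
      (X : ℝ) ^ n * (n * (Real.log c + Real.log X)) := by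
    have := Finset.sum_le_card_nsmul (coordBox b U X)
      (fun a ↦ Real.log (Ideal.absNorm (Ideal.span {a}))) (n * (Real.log c + Real.log X))
      fun a ha ↦ by
        rw [← Real.log_mul (by positivity) hX0.ne', ← Real.log_pow]
        refine Real.log_le_log ?_ (by exact_mod_cast (hbox X hX a ha).2)
        exact_mod_cast (pow_pos hX n).trans_le (hbox X hX a ha).1
    rwa [card_coordBox, card_basisIndex_eq_finrank, nsmul_eq_mul, Nat.cast_pow] at this
  have hge : (X : ℝ) ^ n * (mertensDegreeOne L (X ^ n) - A * D) ≤
      ∑ q ∈ primeIdealsLE (𝓞 L) ((c * X) ^ n), ∑ k ∈ Finset.Icc 1 ((c * X) ^ n),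
        Real.log (Ideal.absNorm q) * coordBoxCount b U X (q ^ k) := by
    have hZ : 1 ≤ (c * X) ^ n := Nat.one_le_pow _ _ (by positivity)
    have hXZ : X ^ n ≤ (c * X) ^ n := Nat.pow_le_pow_left (Nat.le_mul_of_pos_left _ hc) n
    calc _ ≤ (X : ℝ) ^ n * (mertensDegreeOne L (X ^ n) - A / X *
          ∑ q ∈ primeIdealsLE (𝓞 L) (X ^ n) with (Ideal.absNorm q).Prime,
            Real.log (Ideal.absNorm q) / Ideal.absNorm q *
              (Ideal.absNorm q : ℝ) ^ (1 / n : ℝ)) := by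
          gcongr _ * (_ - ?_)
          refine (mul_le_mul_of_nonneg_left (hsum (X ^ n)) (by positivity)).trans_eq ?_
          rw [natCast_pow_rpow_one_div hn0]
          field_simp
      _ = ∑ q ∈ primeIdealsLE (𝓞 L) (X ^ n) with (Ideal.absNorm q).Prime,
            Real.log (Ideal.absNorm q) / Ideal.absNorm q * ((X : ℝ) ^ n *
              (1 - A * ((Ideal.absNorm q : ℝ) ^ (1 / n : ℝ) / X))) := by
          rw [mertensDegreeOne, Finset.mul_sum, ← Finset.sum_sub_distrib, Finset.mul_sum]
          exact Finset.sum_congr rfl fun q _ ↦ by ring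
      _ ≤ ∑ q ∈ primeIdealsLE (𝓞 L) (X ^ n) with (Ideal.absNorm q).Prime,
            Real.log (Ideal.absNorm q) * coordBoxCount b U X (q ^ 1) := by
          refine Finset.sum_le_sum fun q hq ↦ ?_
          have hp := (Finset.mem_filter.1 hq).2
          have hN0 : (Ideal.absNorm q : ℝ) ≠ 0 := by exact_mod_cast hp.ne_zero
          refine (mul_le_mul_of_nonneg_left (hcnt q hp.ne_zero U X hX).1
            (by simpa using log_div_nonneg (Ideal.absNorm q) 1)).trans_eq ?_
          rw [pow_one]
          field_simp
      _ ≤ ∑ q ∈ primeIdealsLE (𝓞 L) ((c * X) ^ n),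
            Real.log (Ideal.absNorm q) * coordBoxCount b U X (q ^ 1) := by
          refine Finset.sum_le_sum_of_subset_of_nonneg (fun q hq ↦ ?_) fun q _ _ ↦
            mul_nonneg (Real.log_natCast_nonneg _) (by positivity)
          have h := mem_primeIdealsLE.1 (Finset.mem_filter.1 hq).1
          exact mem_primeIdealsLE.2 ⟨h.1.trans hXZ, h.2⟩
      _ ≤ _ := by
          refine Finset.sum_le_sum fun q _ ↦ ?_
          exact Finset.single_le_sum
            (f := fun k ↦ Real.log (Ideal.absNorm q) * coordBoxCount b U X (q ^ k))
            (fun k _ ↦ mul_nonneg (Real.log_natCast_nonneg _) (by positivity))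
            (Finset.mem_Icc.2 ⟨le_rfl, hZ⟩)
  have := le_of_mul_le_mul_left ((hge.trans hT.ge).trans hle) (by positivity)
  linarith

lemma one_add_pow_le_one_add_mul {s : ℝ} (hs : 0 ≤ s) (n : ℕ) :
    (1 + s) ^ n ≤ 1 + n * s * (1 + s) ^ n := by
  induction n with
  | zero => simp
  | succ n ih =>
    have h1 : (1 + s) ^ n ≤ (1 + s) ^ (n + 1) := pow_le_pow_right₀ (by linarith) (by omega)
    have h2 : n * s * (1 + s) ^ n ≤ n * s * (1 + s) ^ (n + 1) := by gcongr
    have h3 : s * (1 + s) ^ n ≤ s * (1 + s) ^ (n + 1) := by gcongr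
    calc (1 + s) ^ (n + 1) = (1 + s) ^ n + s * (1 + s) ^ n := by ring
      _ ≤ 1 + n * s * (1 + s) ^ (n + 1) + s * (1 + s) ^ (n + 1) := by linarith
      _ = _ := by push_cast; ring

lemma coordBoxCount_eq_zero {R : Type*} [CommRing R] [IsDedekindDomain R] [Module.Free ℤ R]
    {ι : Type*} [Fintype ι] {b : Module.Basis ι ℤ R} {u : ι → ℤ} {X Z : ℕ} {I : Ideal R}
    (h : ∀ a ∈ coordBox b u X, Ideal.absNorm (Ideal.span {a}) ≠ 0 ∧
      Ideal.absNorm (Ideal.span {a}) ≤ Z) (hI : Z < Ideal.absNorm I) :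
    coordBoxCount b u X I = 0 := by
  classical
  refine Finset.card_eq_zero.2 (Finset.filter_eq_empty_iff.2 fun a ha haI ↦ ?_)
  have := Nat.le_of_dvd (Nat.pos_of_ne_zero (h a ha).1)
    (Ideal.absNorm_dvd_absNorm_of_le ((Ideal.span_singleton_le_iff_mem I).2 haI))
  have := (h a ha).2
  omega

lemma exists_le_mertensDegreeOne :
    ∃ (C : ℝ) (c : ℕ), 0 < c ∧ ∀ X : ℕ, 0 < X → Module.finrank ℚ L * Real.log X - C ≤
      mertensDegreeOne L ((c * X) ^ Module.finrank ℚ L) := by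
  obtain ⟨u, c, hc, hbox⟩ := exists_box_absNorm_bounds L
  obtain ⟨A, hA, hcnt⟩ := exists_coordBoxCount_real_bounds (RingOfIntegers.basis L)
  obtain ⟨H, hH, hhigh⟩ := exists_sum_higher_prime_powers_le (𝓞 L)
  set n := Module.finrank ℚ L with hn
  have hn0 : n ≠ 0 := Module.finrank_pos.ne'
  have hn1 : (1 : ℝ) ≤ n := by exact_mod_cast Nat.one_le_iff_ne_zero.2 hn0
  simp only [card_basisIndex_eq_finrank, ← hn] at hcnt
  obtain ⟨D, hD, hsum⟩ := exists_sum_log_absNorm_mul_rpow_le (𝓞 L) (α := 1 / n) (by positivity)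
    ((div_le_one (by positivity)).2 hn1)
  set G : ℝ := (1 + A * c) ^ n with hG
  have hG0 : 0 ≤ G := by positivity
  refine ⟨n * A * G * (D * c) + G * H, c, hc, fun X hX ↦ ?_⟩
  have hX0 : (0 : ℝ) < X := by exact_mod_cast hX
  set b := RingOfIntegers.basis L
  set U : Module.Free.ChooseBasisIndex ℤ (𝓞 L) → ℤ := fun i ↦ X * u i
  set Z := (c * X) ^ n with hZ
  have hboxZ : ∀ a ∈ coordBox b U X, Ideal.absNorm (Ideal.span {a}) ≠ 0 ∧
      Ideal.absNorm (Ideal.span {a}) ≤ Z := fun a ha ↦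
    ⟨((pow_pos hX n).trans_le (hbox X hX a ha).1).ne', (hbox X hX a ha).2⟩
  have hZ1 : 1 ≤ Z := Nat.one_le_pow _ _ (by positivity)
  have hge : (X : ℝ) ^ n * (n * Real.log X) ≤
      ∑ a ∈ coordBox b U X, Real.log (Ideal.absNorm (Ideal.span {a})) := by
    have := Finset.card_nsmul_le_sum (coordBox b U X)
      (fun a ↦ Real.log (Ideal.absNorm (Ideal.span {a}))) (n * Real.log X)
      fun a ha ↦ by
        rw [← Real.log_pow]
        exact Real.log_le_log (by positivity) (by exact_mod_cast (hbox X hX a ha).1)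
    rwa [card_coordBox, card_basisIndex_eq_finrank, nsmul_eq_mul, Nat.cast_pow] at this
  set f : Ideal (𝓞 L) → ℝ := fun q ↦ Real.log (Ideal.absNorm q) / Ideal.absNorm q +
    n * A * G / X * (Real.log (Ideal.absNorm q) / Ideal.absNorm q *
      (Ideal.absNorm q : ℝ) ^ (1 / n : ℝ)) with hf
  have hlog : ∀ q : Ideal (𝓞 L), 0 ≤ Real.log (Ideal.absNorm q) / Ideal.absNorm q := fun q ↦ by
    simpa using log_div_nonneg (Ideal.absNorm q) 1
  have hf0 : ∀ q, 0 ≤ f q := fun q ↦ add_nonneg (hlog q)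
    (mul_nonneg (by positivity) (mul_nonneg (hlog q) (by positivity)))
  have hterm : ∀ q ∈ primeIdealsLE (𝓞 L) Z, ∀ k ∈ Finset.Icc 1 Z,
      Real.log (Ideal.absNorm q) * coordBoxCount b U X (q ^ k) ≤ (X : ℝ) ^ n *
        ((if k = 1 ∧ (Ideal.absNorm q).Prime then f q else 0) +
          G * (if k = 1 ∧ (Ideal.absNorm q).Prime then 0 else
            Real.log (Ideal.absNorm q) / (Ideal.absNorm q : ℝ) ^ k)) := by
    intro q hq k hk
    obtain ⟨-, hq0, hqp⟩ := mem_primeIdealsLE.1 hq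
    have hN1 := one_lt_absNorm_of_isPrime hq0 hqp
    have hN0 : (0 : ℝ) < Ideal.absNorm q := by positivity
    rcases lt_or_ge Z (Ideal.absNorm (q ^ k)) with hlt | hle
    · rw [coordBoxCount_eq_zero hboxZ hlt]
      have := hf0 q
      have := log_div_nonneg (Ideal.absNorm q) k
      simp only [Nat.cast_zero, mul_zero]
      split_ifs <;> positivity
    have hne : Ideal.absNorm (q ^ k) ≠ 0 := by rw [map_pow]; positivity
    set t : ℝ := (Ideal.absNorm (q ^ k) : ℝ) ^ (1 / n : ℝ) with ht
    have ht0 : 0 ≤ t := by positivity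
    have htX : t / X ≤ c := by
      rw [div_le_iff₀ hX0, ← Nat.cast_mul, ← natCast_pow_rpow_one_div (X := c * X) hn0]
      exact Real.rpow_le_rpow (by positivity) (by exact_mod_cast hle) (by positivity)
    have h1 : (1 + A * (t / X)) ^ n ≤ G := by rw [hG]; gcongr
    have h2 : (1 + A * (t / X)) ^ n ≤ 1 + n * (A * (t / X)) * G :=
      (one_add_pow_le_one_add_mul (by positivity) n).trans (by gcongr)
    have h3 : Real.log (Ideal.absNorm q) * coordBoxCount b U X (q ^ k) ≤
        (X : ℝ) ^ n * ((1 + A * (t / X)) ^ n *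
          (Real.log (Ideal.absNorm q) / (Ideal.absNorm q : ℝ) ^ k)) := by
      have h4 := (hcnt (q ^ k) hne U X hX).2
      have h5 := mul_le_mul_of_nonneg_left h4 (log_div_nonneg (Ideal.absNorm q) k)
      refine le_trans (le_of_eq ?_) (h5.trans_eq ?_)
      · rw [map_pow, Nat.cast_pow]; field_simp
      · ring
    refine h3.trans (mul_le_mul_of_nonneg_left ?_ (by positivity))
    split_ifs with h
    · obtain ⟨rfl, -⟩ := h
      rw [mul_zero, add_zero, pow_one, hf]
      refine (mul_le_mul_of_nonneg_right h2 (hlog q)).trans_eq ?_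
      rw [ht, pow_one]
      ring
    · rw [zero_add]
      exact mul_le_mul_of_nonneg_right h1 (log_div_nonneg _ _)
  have hfsum : ∑ q ∈ primeIdealsLE (𝓞 L) Z with (Ideal.absNorm q).Prime, f q ≤
      mertensDegreeOne L Z + n * A * G * (D * c) := by
    rw [hf, Finset.sum_add_distrib, ← Finset.mul_sum]
    refine add_le_add le_rfl ?_
    refine (mul_le_mul_of_nonneg_left (hsum Z) (by positivity)).trans_eq ?_
    rw [hZ, natCast_pow_rpow_one_div hn0]
    push_cast
    field_simp
  have hupper : ∑ q ∈ primeIdealsLE (𝓞 L) Z, ∑ k ∈ Finset.Icc 1 Z,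
      Real.log (Ideal.absNorm q) * coordBoxCount b U X (q ^ k) ≤
      (X : ℝ) ^ n * (mertensDegreeOne L Z + n * A * G * (D * c) + G * H) := by
    refine (Finset.sum_le_sum fun q hq ↦ Finset.sum_le_sum (hterm q hq)).trans ?_
    simp_rw [← Finset.mul_sum, Finset.sum_add_distrib, ← Finset.mul_sum]
    have hite : ∀ q ∈ primeIdealsLE (𝓞 L) Z, (∑ k ∈ Finset.Icc 1 Z,
        if k = 1 ∧ (Ideal.absNorm q).Prime then f q else 0) =
        if (Ideal.absNorm q).Prime then f q else 0 := fun q _ ↦ by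
      rw [Finset.sum_eq_single_of_mem 1 (Finset.mem_Icc.2 ⟨le_rfl, hZ1⟩)]
      · simp
      · intro k _ hk
        simp [hk]
    rw [Finset.sum_congr rfl hite, ← Finset.sum_filter]
    gcongr
    exact hhigh Z
  have := le_of_mul_le_mul_left ((hge.trans_eq
    (sum_log_absNorm_box b U X Z hboxZ)).trans hupper) (by positivity)
  linarith

end DegreeOne

section Many

variable (L : Type*) [Field L] [NumberField L]

lemma exists_one_le_sum_degree_one :
    ∃ C : ℕ, 0 < C ∧ ∀ P : ℕ, 0 < P → 1 ≤
      ∑ q ∈ primeIdealsLE (𝓞 L) (C * P) with (Ideal.absNorm q).Prime ∧ P ≤ Ideal.absNorm q,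
        Real.log (Ideal.absNorm q) / Ideal.absNorm q := by
  obtain ⟨C₁, hu⟩ := exists_mertensDegreeOne_le L
  obtain ⟨C₂, c, hc, hl⟩ := exists_le_mertensDegreeOne L
  set n := Module.finrank ℚ L with hn
  have hn0 : n ≠ 0 := Module.finrank_pos.ne'
  have hn1 : (1 : ℝ) ≤ n := by exact_mod_cast Nat.one_le_iff_ne_zero.2 hn0
  obtain ⟨E, hE⟩ := exists_nat_ge (Real.exp (1 + |C₁| + |C₂|))
  have hE0 : (0 : ℝ) < E := (Real.exp_pos _).trans_le hE
  have hEn : 0 < E := by exact_mod_cast hE0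
  have hElog : 1 + |C₁| + |C₂| ≤ Real.log E := (Real.le_log_iff_exp_le hE0).2 hE
  refine ⟨(2 * (c * E)) ^ n, by positivity, fun P hP ↦ ?_⟩
  have hP1 : (1 : ℝ) ≤ P := by exact_mod_cast hP
  set t : ℝ := (P : ℝ) ^ (1 / n : ℝ) with ht
  have htn : t ^ n = P := by rw [ht, one_div, Real.rpow_inv_natCast_pow (by positivity) hn0]
  have ht1 : 1 ≤ t := Real.one_le_rpow hP1 (by positivity)
  set X := ⌈t⌉₊ with hX
  have htX : t ≤ X := Nat.le_ceil t
  have hXt : (X : ℝ) ≤ 2 * t := by linarith [Nat.ceil_lt_add_one (zero_le_one.trans ht1)]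
  have hX0 : 0 < X := Nat.ceil_pos.2 (by linarith)
  have hX0' : (0 : ℝ) < X := by exact_mod_cast hX0
  have hPX : P ≤ X ^ n := by
    have : (P : ℝ) ≤ (X : ℝ) ^ n := by rw [← htn]; gcongr
    exact_mod_cast this
  have hXP : (c * (E * X)) ^ n ≤ (2 * (c * E)) ^ n * P := by
    have : ((c : ℝ) * (E * X)) ^ n ≤ (2 * (c * E)) ^ n * P := by
      rw [← htn, ← mul_pow]
      refine pow_le_pow_left₀ (by positivity) ?_ n
      calc (c : ℝ) * (E * X) ≤ c * (E * (2 * t)) := by gcongr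
        _ = _ := by ring
    exact_mod_cast this
  have h1 := hu X hX0
  have h2 := hl (E * X) (by positivity)
  rw [Nat.cast_mul, Real.log_mul hE0.ne' hX0'.ne'] at h2
  have hdiff : 1 ≤ mertensDegreeOne L ((c * (E * X)) ^ n) - mertensDegreeOne L (X ^ n) := by
    have h3 : Real.log E ≤ n * Real.log E :=
      le_mul_of_one_le_left (by linarith [abs_nonneg C₁, abs_nonneg C₂]) hn1
    linarith [le_abs_self C₁, le_abs_self C₂]
  refine hdiff.trans (sub_le_iff_le_add.2 ?_)
  rw [mertensDegreeOne, mertensDegreeOne,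
    ← Finset.sum_filter_add_sum_filter_not _ (fun q ↦ X ^ n < Ideal.absNorm q)]
  have hlog : ∀ q : Ideal (𝓞 L), 0 ≤ Real.log (Ideal.absNorm q) / Ideal.absNorm q := fun q ↦ by
    simpa using log_div_nonneg (Ideal.absNorm q) 1
  refine add_le_add ?_ ?_ <;>
    refine Finset.sum_le_sum_of_subset_of_nonneg (fun q hq ↦ ?_) fun q _ _ ↦ hlog q
  · simp only [Finset.mem_filter, mem_primeIdealsLE] at hq ⊢
    exact ⟨⟨hq.1.1.1.trans hXP, hq.1.1.2⟩, hq.1.2, hPX.trans hq.2.le⟩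
  · simp only [Finset.mem_filter, mem_primeIdealsLE] at hq ⊢
    exact ⟨⟨not_lt.1 hq.2, hq.1.1.2⟩, hq.1.2⟩

/-- There are many rational primes in `[P, C P]` which are norms of prime ideals. -/
lemma exists_finset_primes_eq_absNorm :
    ∃ C : ℕ, 0 < C ∧ ∀ r : ℕ, ∃ P₀ : ℕ, ∀ P : ℕ, P₀ ≤ P → ∃ T : Finset ℕ, r ≤ T.card ∧
      ∀ p ∈ T, p.Prime ∧ P ≤ p ∧ p ≤ C * P ∧
        ∃ q : Ideal (𝓞 L), q.IsPrime ∧ Ideal.absNorm q = p := by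
  classical
  obtain ⟨C, hC, hsum⟩ := exists_one_le_sum_degree_one L
  refine ⟨C, hC, fun r ↦ ?_⟩
  set n := Module.finrank ℤ (𝓞 L) with hn
  refine ⟨(2 * n * r * C) ^ 2 + 1, fun P hP ↦ ?_⟩
  have hP0 : 0 < P := by omega
  have hP0' : (0 : ℝ) < P := by exact_mod_cast hP0
  set S := (primeIdealsLE (𝓞 L) (C * P)).filter
    fun q ↦ (Ideal.absNorm q).Prime ∧ P ≤ Ideal.absNorm q with hS
  have hmem : ∀ q ∈ S, q.IsPrime ∧ (Ideal.absNorm q).Prime ∧ P ≤ Ideal.absNorm q ∧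
      Ideal.absNorm q ≤ C * P := fun q hq ↦ by
    simp only [hS, Finset.mem_filter, mem_primeIdealsLE] at hq
    exact ⟨hq.1.2.2, hq.2.1, hq.2.2, hq.1.1⟩
  refine ⟨S.image Ideal.absNorm, ?_, fun p hp ↦ ?_⟩
  swap
  · obtain ⟨q, hq, rfl⟩ := Finset.mem_image.1 hp
    obtain ⟨h1, h2, h3, h4⟩ := hmem q hq
    exact ⟨h2, h3, h4, q, h1, rfl⟩
  have hfib : S.card ≤ n * (S.image Ideal.absNorm).card := by
    refine Finset.card_le_mul_card_image _ _ fun p hp ↦ ?_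
    obtain ⟨q, hq, rfl⟩ := Finset.mem_image.1 hp
    have hpp := (hmem q hq).2.1
    refine card_primes_le_finrank hpp (Nat.cast_ne_zero.2 hpp.ne_zero) _ fun q' hq' ↦ ?_
    obtain ⟨h1, h2⟩ := Finset.mem_filter.1 hq'
    exact ⟨(hmem q' h1).1, h2 ▸ Ideal.absNorm_mem q'⟩
  set y : ℝ := C * P with hy
  have hy1 : 0 < y := by positivity
  have hcard : (P : ℝ) ≤ S.card * Real.log y := by
    have h1 := (hsum P hP0).trans (Finset.sum_le_card_nsmul S _ (Real.log y / P) fun q hq ↦ by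
      obtain ⟨h1, h2, h3, h4⟩ := hmem q hq
      have hq0 : (0 : ℝ) < Ideal.absNorm q := by exact_mod_cast h2.pos
      have hqy : (Ideal.absNorm q : ℝ) ≤ y := by rw [hy]; exact_mod_cast h4
      have hlogy : 0 ≤ Real.log y :=
        (Real.log_natCast_nonneg (Ideal.absNorm q)).trans (Real.log_le_log hq0 hqy)
      gcongr)
    rw [nsmul_eq_mul, ← mul_div_assoc, le_div_iff₀ hP0', one_mul] at h1
    exact h1
  by_contra! hr
  have hSr : (S.card : ℝ) ≤ n * r := by
    exact_mod_cast hfib.trans (Nat.mul_le_mul_left n hr.le)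
  have hlogy : Real.log y ≤ 2 * Real.sqrt y := by
    have := Real.log_le_rpow_div hy1.le (show (0 : ℝ) < 1 / 2 by norm_num)
    rw [← Real.sqrt_eq_rpow] at this
    linarith
  have hsq : 2 * n * r * C < Real.sqrt y := by
    refine Real.lt_sqrt_of_sq_lt ?_
    have h1 : ((2 * n * r * C : ℕ) : ℝ) ^ 2 + 1 ≤ P := by exact_mod_cast hP
    have h2 : (P : ℝ) ≤ y := le_mul_of_one_le_left hP0'.le (by exact_mod_cast hC)
    push_cast at h1
    linarith
  have hss : Real.sqrt y * Real.sqrt y = C * P := Real.mul_self_sqrt hy1.le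
  have hs0 : 0 < Real.sqrt y := Real.sqrt_pos.2 hy1
  have h5 : (P : ℝ) ≤ n * r * (2 * Real.sqrt y) :=
    hcard.trans ((mul_le_mul_of_nonneg_left hlogy (by positivity)).trans (by gcongr))
  have h6 : (C : ℝ) * P ≤ C * (n * r * (2 * Real.sqrt y)) := by gcongr
  nlinarith

end Many

/-- There are many totally split primes in `[P, C P]`. -/
lemma exists_finset_totallySplit (K : Type*) [Field K] [NumberField K] :
    ∃ C : ℕ, 0 < C ∧ ∀ r : ℕ, ∃ P₀ : ℕ, ∀ P : ℕ, P₀ ≤ P → ∃ T : Finset ℕ, r ≤ T.card ∧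
      ∀ p ∈ T, p.Prime ∧ P ≤ p ∧ p ≤ C * P ∧ TotallySplit K p ∧
        ∃ q : Ideal (𝓞 K), q.IsPrime ∧ Ideal.absNorm q = p := by
  obtain ⟨L, _, _, ⟨_⟩⟩ := exists_numberField_isGalois K
  obtain ⟨C, hC, h⟩ := exists_finset_primes_eq_absNorm L
  refine ⟨C, hC, fun r ↦ ?_⟩
  obtain ⟨P₀, h⟩ := h r
  refine ⟨max P₀ ((discr K).natAbs + 1), fun P hP ↦ ?_⟩
  obtain ⟨T, hT, h⟩ := h P (le_of_max_le_left hP)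
  refine ⟨T, hT, fun p hp ↦ ?_⟩
  obtain ⟨h1, h2, h3, Q, hQ, hQp⟩ := h p hp
  have hd : ¬ (p : ℤ) ∣ discr K := fun hd ↦ by
    have := Nat.le_of_dvd (Int.natAbs_pos.2 (discr_ne_zero K)) (Int.natCast_dvd.1 hd)
    have := le_of_max_le_right hP
    omega
  obtain ⟨h4, h5⟩ := exists_totallySplit_of_absNorm_eq h1 hd Q hQp
  exact ⟨h1, h2, h3, h4, h5⟩

section House

variable {K : Type*} [Field K] [NumberField K]

lemma house_coeff_le_mvHousePlus (F : MvPolynomial (Fin 2) (𝓞 K)) {m : Fin 2 →₀ ℕ}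
    (hm : m ∈ F.support) : house ((F.coeff m : 𝓞 K) : K) ≤ mvHousePlus F := by
  refine le_max_of_le_right (le_ciSup_of_le ⟨∑ m ∈ F.support, house ((F.coeff m : 𝓞 K) : K), ?_⟩ m
    (ciSup_pos (f := fun _ ↦ house ((F.coeff m : 𝓞 K) : K)) hm).ge)
  rintro _ ⟨i, rfl⟩
  by_cases hi : i ∈ F.support
  · simp only [ciSup_pos hi]
    exact Finset.single_le_sum (f := fun m ↦ house ((F.coeff m : 𝓞 K) : K))
      (fun _ _ ↦ house_nonneg _) hi
  · simp only [hi, Real.iSup_of_isEmpty]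
    exact Finset.sum_nonneg fun _ _ ↦ house_nonneg _

lemma eval_pderiv_zero_eq_sum (F : MvPolynomial (Fin 2) (𝓞 K)) (x₁ x₂ : 𝓞 K) :
    MvPolynomial.eval ![x₁, x₂] (MvPolynomial.pderiv 0 F) =
      ∑ m ∈ F.support with m 0 ≠ 0, (m 0 : 𝓞 K) * F.coeff m * (x₁ ^ (m 0 - 1) * x₂ ^ m 1) := by
  conv_lhs => rw [F.as_sum]
  rw [map_sum, map_sum, Finset.sum_filter]
  refine Finset.sum_congr rfl fun m _ ↦ ?_
  rw [MvPolynomial.pderiv_monomial, MvPolynomial.eval_monomial]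
  split_ifs with h
  · rw [Finsupp.prod_fintype _ _ fun _ ↦ pow_zero _, Fin.prod_univ_two]
    simp only [Finsupp.tsub_apply, Finsupp.single_eq_same,
      Finsupp.single_eq_of_ne (one_ne_zero : (1 : Fin 2) ≠ 0), Matrix.cons_val_zero,
      Matrix.cons_val_one, tsub_zero]
    ring
  · rw [not_not] at h
    simp [h]

lemma house_eval_pderiv_zero_le (F : MvPolynomial (Fin 2) (𝓞 K)) (hd : 1 ≤ F.totalDegree)
    {B : ℝ} (hB : 1 ≤ B) {x₁ x₂ : 𝓞 K} (h₁ : house (x₁ : K) ≤ B) (h₂ : house (x₂ : K) ≤ B) :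
    house ((MvPolynomial.eval ![x₁, x₂] (MvPolynomial.pderiv 0 F) : 𝓞 K) : K) ≤
      (F.totalDegree : ℝ) ^ 3 * mvHousePlus F * B ^ (F.totalDegree - 1) := by
  classical
  set d := F.totalDegree
  have hH : 0 ≤ mvHousePlus F := zero_le_one.trans (le_max_left _ _)
  set s := F.support.filter fun m ↦ m 0 ≠ 0 with hs
  have hdeg : ∀ m ∈ s, m ∈ F.support ∧ m 0 ≠ 0 ∧ m 0 + m 1 ≤ d := fun m hm ↦ by
    obtain ⟨hm1, hm2⟩ := Finset.mem_filter.1 hm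
    refine ⟨hm1, hm2, ?_⟩
    have := MvPolynomial.le_totalDegree hm1
    rwa [Finsupp.sum_fintype _ _ fun _ ↦ rfl, Fin.sum_univ_two] at this
  have hcard : s.card ≤ d * d := by
    calc s.card ≤ (Finset.range d ×ˢ Finset.range d).card := by
          refine Finset.card_le_card_of_injOn (fun m ↦ (m 0 - 1, m 1)) (fun m hm ↦ ?_) ?_
          · obtain ⟨-, h2, h3⟩ := hdeg m hm
            simp only [Finset.coe_product, Set.mem_prod, Finset.mem_coe, Finset.mem_range]
            omega
          · intro m hm m' hm' h
            have h2 := (hdeg m hm).2.1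
            have h2' := (hdeg m' hm').2.1
            simp only [Prod.mk.injEq] at h
            ext i
            fin_cases i
            · simp only [Fin.zero_eta]; omega
            · exact h.2
      _ = d * d := by simp
  have hterm : ∀ m ∈ s, house (((m 0 : 𝓞 K) * F.coeff m * (x₁ ^ (m 0 - 1) * x₂ ^ m 1) : 𝓞 K) : K) ≤
      d * mvHousePlus F * B ^ (d - 1) := fun m hm ↦ by
    obtain ⟨h1, h2, h3⟩ := hdeg m hm
    have hpow : ∀ {x : 𝓞 K} (k : ℕ), house (x : K) ≤ B → house ((x : K) ^ k) ≤ B ^ k :=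
      fun k hx ↦ (house_pow_le _ _).trans (pow_le_pow_left₀ (house_nonneg _) hx k)
    push_cast
    refine (house_mul_le _ _).trans (mul_le_mul ?_ ?_ (house_nonneg _) (by positivity))
    · rw [house_nat_mul]
      exact mul_le_mul (by exact_mod_cast (by omega : m 0 ≤ d)) (house_coeff_le_mvHousePlus F h1)
        (house_nonneg _) (by positivity)
    · calc _ ≤ B ^ (m 0 - 1) * B ^ (m 1) := (house_mul_le _ _).trans
            (mul_le_mul (hpow _ h₁) (hpow _ h₂) (house_nonneg _) (by positivity))
        _ = B ^ (m 0 - 1 + m 1) := (pow_add _ _ _).symm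
        _ ≤ B ^ (d - 1) := pow_le_pow_right₀ hB (by omega)
  rw [eval_pderiv_zero_eq_sum]
  calc _ ≤ _ := (congrArg house (map_sum (algebraMap (𝓞 K) K) _ _)).trans_le
        (house_sum_le_sum_house _ _)
    _ ≤ ∑ m ∈ s, d * mvHousePlus F * B ^ (d - 1) := Finset.sum_le_sum hterm
    _ = s.card * (d * mvHousePlus F * B ^ (d - 1)) := by rw [Finset.sum_const, nsmul_eq_mul]
    _ ≤ (d * d : ℕ) * (d * mvHousePlus F * B ^ (d - 1)) := by gcongr
    _ = _ := by push_cast; ring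

lemma absNorm_span_singleton_le_house_pow (z : 𝓞 K) :
    (Ideal.absNorm (Ideal.span {z}) : ℝ) ≤ house (z : K) ^ Module.finrank ℚ K := by
  rw [absNorm_span_singleton_eq_prod, ← Embeddings.card K ℂ, ← Finset.card_univ,
    ← Finset.prod_const]
  exact Finset.prod_le_prod (fun _ _ ↦ norm_nonneg _) fun σ _ ↦ norm_embedding_le_house _ _

/-- A nonzero element contained in many primes has large norm. -/
lemma two_pow_le_absNorm_of_forall_mem {r : ℕ} {𝔭 : Fin r → Ideal (𝓞 K)}
    (hinj : Function.Injective 𝔭) (hp : ∀ i, (𝔭 i).IsPrime ∧ 2 ≤ Ideal.absNorm (𝔭 i))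
    {z : 𝓞 K} (hz : z ≠ 0) (hmem : ∀ i, z ∈ 𝔭 i) :
    2 ^ r ≤ Ideal.absNorm (Ideal.span {z}) := by
  classical
  have hdvd : ∏ q ∈ Finset.univ.image 𝔭, q ∣ Ideal.span {z} := by
    refine Finset.prod_primes_dvd _ (fun q hq ↦ ?_) fun q hq ↦ ?_ <;>
      obtain ⟨i, -, rfl⟩ := Finset.mem_image.1 hq
    · refine Ideal.prime_of_isPrime (fun h ↦ ?_) (hp i).1
      have := (hp i).2
      simp [h] at this
    · exact Ideal.dvd_span_singleton.2 (hmem i)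
  rw [Finset.prod_image hinj.injOn] at hdvd
  have h1 := Ideal.absNorm_dvd_absNorm_of_le (Ideal.dvd_iff_le.1 hdvd)
  have h0 : Ideal.absNorm (Ideal.span {z}) ≠ 0 := by
    rwa [Ne, Ideal.absNorm_eq_zero_iff, Ideal.span_singleton_eq_bot]
  refine le_trans ?_ (Nat.le_of_dvd (Nat.pos_of_ne_zero h0) h1)
  rw [map_prod]
  calc 2 ^ r = ∏ _i : Fin r, 2 := by simp
    _ ≤ _ := Finset.prod_le_prod' fun i _ ↦ (hp i).2

end House

lemma half_le_div_log_mul_log {x : ℝ} (hx : 256 ≤ x) :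
    x / 2 ≤ x / Real.log x * Real.log (x / Real.log x) := by
  have hx0 : 0 < x := by linarith
  have hlog : 0 < Real.log x := Real.log_pos (by linarith)
  set y : ℝ := x ^ (1 / 4 : ℝ) with hy
  have hy0 : 0 < y := by positivity
  have hy4 : y ^ 4 = x := by
    rw [hy, ← Real.rpow_natCast, ← Real.rpow_mul hx0.le]; norm_num
  have hle : Real.log x ≤ 4 * y := by
    have := Real.log_le_rpow_div hx0.le (show (0 : ℝ) < 1 / 4 by norm_num)
    linarith
  have h4y : 4 ≤ y := by
    by_contra! h
    have : y ^ 4 < 4 ^ 4 := pow_lt_pow_left₀ h hy0.le (by norm_num)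
    rw [hy4] at this
    norm_num at this
    linarith
  have h1 : y ^ 2 ≤ x / Real.log x := by
    rw [le_div_iff₀ hlog]
    calc y ^ 2 * Real.log x ≤ y ^ 2 * (y * y) := by gcongr; nlinarith
      _ = x := by rw [← hy4]; ring
  have h2 : Real.log x / 2 ≤ Real.log (x / Real.log x) := by
    refine le_trans (le_of_eq ?_) (Real.log_le_log (by positivity) h1)
    rw [← hy4, Real.log_pow, Real.log_pow]
    push_cast
    ring
  calc x / 2 = x / Real.log x * (Real.log x / 2) := by field_simp
    _ ≤ _ := by gcongr

/-- For `F ∈ O_K[X₁,X₂]` of total degree `d ≥ 2` and `B > 1`, with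
`h(B) = log₂(d³ H⁺(F) B^{d-1})` and `r = ⌊ρ h(B)⌋ + 1`, there are a constant `C₁ > 0`
depending only on `K` and a threshold `P₀` such that for every integer `P ≥ P₀` there are `r`
distinct prime ideals `𝔭₁,…,𝔭_r` of `O_K`, each above a totally split rational prime, with
`P ≤ N(𝔭ᵢ) ≤ C₁ h(B)² (P/log P) log(P/log P)`, such that every zero `(x₁,x₂)` of `F` with
houses `≤ B` and `(∂F/∂X₁)(x₁,x₂) ≠ 0` satisfies `(∂F/∂X₁)(x₁,x₂) ∉ 𝔭ᵢ` for some `i`. -/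
theorem exists_split_primes_covering (K : Type*) [Field K] [NumberField K] :
    ∃ C₁ > (0 : ℝ),
      ∀ F : MvPolynomial (Fin 2) (𝓞 K), 2 ≤ F.totalDegree →
      ∀ B : ℝ, 1 < B →
        ∃ P₀ : ℕ, ∀ P : ℕ, P₀ ≤ P →
          ∃ 𝔭 : Fin (⌊(Module.finrank ℚ K : ℝ) *
              Real.logb 2 ((F.totalDegree : ℝ) ^ 3 * mvHousePlus F *
                B ^ ((F.totalDegree : ℝ) - 1))⌋₊ + 1) → Ideal (𝓞 K),
            Function.Injective 𝔭 ∧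
            (∀ i, (𝔭 i).IsPrime) ∧
            (∀ i, ∃ p : ℕ, p.Prime ∧ TotallySplit K p ∧ (p : 𝓞 K) ∈ 𝔭 i) ∧
            (∀ i, (P : ℝ) ≤ (Ideal.absNorm (𝔭 i) : ℝ) ∧
              (Ideal.absNorm (𝔭 i) : ℝ) ≤
                C₁ * (Real.logb 2 ((F.totalDegree : ℝ) ^ 3 * mvHousePlus F *
                    B ^ ((F.totalDegree : ℝ) - 1))) ^ 2 *
                  ((P : ℝ) / Real.log P) * Real.log ((P : ℝ) / Real.log P)) ∧
            (∀ x₁ x₂ : 𝓞 K,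
              MvPolynomial.eval ![x₁, x₂] F = 0 →
              house (x₁ : K) ≤ B → house (x₂ : K) ≤ B →
              MvPolynomial.eval ![x₁, x₂] (MvPolynomial.pderiv 0 F) ≠ 0 →
              ∃ i, MvPolynomial.eval ![x₁, x₂] (MvPolynomial.pderiv 0 F) ∉ 𝔭 i) := by
  obtain ⟨C, hC, hprimes⟩ := exists_finset_totallySplit K
  refine ⟨2 * C, by positivity, fun F hF B hB ↦ ?_⟩
  have hexp : B ^ ((F.totalDegree : ℝ) - 1) = B ^ (F.totalDegree - 1) := by
    rw [← Real.rpow_natCast, Nat.cast_sub (by omega), Nat.cast_one]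
  rw [hexp]
  set W : ℝ := (F.totalDegree : ℝ) ^ 3 * mvHousePlus F * B ^ (F.totalDegree - 1) with hW
  have hW2 : 2 ≤ W := by
    have h1 : (2 : ℝ) ≤ F.totalDegree := by exact_mod_cast hF
    have h2 : (2 : ℝ) ^ 3 ≤ (F.totalDegree : ℝ) ^ 3 := by gcongr
    have h3 : 1 ≤ mvHousePlus F := le_max_left _ _
    have h4 : 1 ≤ B ^ (F.totalDegree - 1) := one_le_pow₀ hB.le
    calc (2 : ℝ) ≤ 2 ^ 3 * 1 * 1 := by norm_num
      _ ≤ W := by rw [hW]; gcongr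
  set h : ℝ := Real.logb 2 W with hh
  have hh1 : 1 ≤ h := by
    rw [hh, Real.le_logb_iff_rpow_le one_lt_two (by linarith), Real.rpow_one]
    exact hW2
  set r : ℕ := ⌊(Module.finrank ℚ K : ℝ) * h⌋₊ + 1 with hr
  obtain ⟨P₀, hP₀⟩ := hprimes r
  refine ⟨max P₀ 256, fun P hP ↦ ?_⟩
  obtain ⟨T, hT, hTp⟩ := hP₀ P (le_of_max_le_left hP)
  have hP256 : 256 ≤ P := le_of_max_le_right hP
  have hmem : ∀ i : Fin r, T.orderEmbOfCardLe hT i ∈ T := fun i ↦ T.orderEmbOfCardLe_mem hT i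
  choose hp hPp hpC hsplit 𝔭 hprime hnorm using fun i ↦ hTp _ (hmem i)
  have hinj : Function.Injective 𝔭 := fun i j hij ↦ by
    apply (T.orderEmbOfCardLe hT).injective
    rw [← hnorm i, ← hnorm j, hij]
  refine ⟨𝔭, hinj, hprime, fun i ↦ ⟨_, hp i, hsplit i, ?_⟩, fun i ↦ ⟨?_, ?_⟩,
    fun x₁ x₂ _ h₁ h₂ hz ↦ ?_⟩
  · have := Ideal.absNorm_mem (𝔭 i)
    rwa [hnorm i] at this
  · rw [hnorm i]
    exact_mod_cast hPp i
  · have h1 : (Ideal.absNorm (𝔭 i) : ℝ) ≤ C * P := by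
      rw [hnorm i]
      exact_mod_cast hpC i
    have h2 := half_le_div_log_mul_log (x := P) (by exact_mod_cast hP256)
    have h3 : 1 ≤ h ^ 2 := one_le_pow₀ hh1
    have hP0 : (0 : ℝ) ≤ P := by positivity
    calc (Ideal.absNorm (𝔭 i) : ℝ) ≤ 2 * C * 1 * (P / 2) := by linarith
      _ ≤ 2 * C * h ^ 2 * (P / Real.log P * Real.log (P / Real.log P)) := by gcongr
      _ = _ := by ring
  · by_contra! hall
    have h1 := two_pow_le_absNorm_of_forall_mem hinj
      (fun i ↦ ⟨hprime i, by rw [hnorm i]; exact (hp i).two_le⟩) hz hall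
    have h2 : ((2 : ℝ)) ^ r ≤ W ^ Module.finrank ℚ K := by
      calc (2 : ℝ) ^ r ≤ _ := by exact_mod_cast h1
        _ ≤ _ := absNorm_span_singleton_le_house_pow _
        _ ≤ _ := pow_le_pow_left₀ (house_nonneg _)
          (house_eval_pderiv_zero_le F (by omega) hB.le h₁ h₂) _
    have h3 : W = (2 : ℝ) ^ h := (Real.rpow_logb two_pos (by norm_num) (by linarith)).symm
    rw [h3, ← Real.rpow_natCast, ← Real.rpow_natCast, ← Real.rpow_mul zero_le_two,
      Real.rpow_le_rpow_left_iff one_lt_two] at h2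
    have h4 := Nat.lt_floor_add_one ((Module.finrank ℚ K : ℝ) * h)
    rw [hr] at h2
    push_cast at h2
    linarith
end
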